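/- arXiv:1807.11134 — 3 statements merged into one kernel-verified Lean document; each statement's English description precedes it below -/
import Mathlib

section
/- Let $F$ be a field that is not algebraically closed, and let $\bar{F}$ be its algebraic closure. Then $\bar{F}$ has infinite dimension as a vector space over $F$, or $[\bar{F}:F] = 2$ and $F$ has characteristic $0$. In particular, if $F$ has characteristic $p > 0$ and is not algebraically closed, then $[\bar{F}:F]$ is infinite. -/
open Polynomial Module IntermediateField

/-- In a Galois extension of prime degree `p` there is an automorphism of order `p` whose fixed
field is the base field. -/
theorem IsGalois.exists_generator_of_finrank_prime {K L : Type*} [Field K] [Field L] [Algebra K L]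
    [FiniteDimensional K L] [IsGalois K L] {p : ℕ} (hp : p.Prime) (hd : finrank K L = p) :
    ∃ σ : Gal(L/K), σ ≠ 1 ∧ σ ^ p = 1 ∧ ∀ x, σ x = x → x ∈ Set.range (algebraMap K L) := by
  have : Fact p.Prime := ⟨hp⟩
  have hc : Nat.card Gal(L/K) = p := (IsGalois.card_aut_eq_finrank K L).trans hd
  have : Nontrivial Gal(L/K) := Finite.one_lt_card_iff_nontrivial.1 (hc ▸ hp.one_lt)
  obtain ⟨σ, hσ⟩ := exists_ne (1 : Gal(L/K))
  refine ⟨σ, hσ, hc ▸ pow_card_eq_one', fun x hx => ?_⟩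
  rw [IsGalois.mem_range_algebraMap_iff_fixed]
  intro τ
  have hτ : τ ∈ Subgroup.zpowers σ := by
    rw [zpowers_eq_top_of_prime_card hc hσ]
    trivial
  have hle : Subgroup.zpowers σ ≤ MulAction.stabilizer Gal(L/K) x :=
    Subgroup.zpowers_le.2 hx
  exact hle hτ

/-- An automorphism of order `p` in characteristic `p` translates some element by `1`. -/
theorem AlgEquiv.exists_apply_eq_add_one {K L : Type*} [Field K] [Field L] [Algebra K L]
    (p : ℕ) [Fact p.Prime] [CharP K p] {σ : Gal(L/K)} (hσ : σ ≠ 1) (hσp : σ ^ p = 1) :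
    ∃ α, σ α = α + 1 := by
  let N : End K L := σ.toLinearMap - 1
  have : CharP L p := charP_of_injective_algebraMap (algebraMap K L).injective p
  have : CharP (End K L) p := charP_of_injective_algebraMap (algebraMap K (End K L)).injective p
  have hpow : ∀ n, (σ.toLinearMap : End K L) ^ n = (σ ^ n).toLinearMap := by
    intro n
    induction n with
    | zero => rfl
    | succ n ih => rw [pow_succ, ih, pow_succ]; rfl
  have hN : IsNilpotent N := by
    refine ⟨p, ?_⟩
    rw [sub_pow_char_of_commute p (Commute.one_right _), hpow, hσp, one_pow]
    exact sub_self _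
  have hN0 : N ≠ 0 := by
    intro h
    exact hσ (AlgEquiv.ext fun x => sub_eq_zero.1 (LinearMap.congr_fun h x))
  obtain ⟨w, hw, hw'⟩ : ∃ w, N w ≠ 0 ∧ N (N w) = 0 := by
    by_contra! H
    obtain ⟨x, hx⟩ : ∃ x, N x ≠ 0 := by
      by_contra! h
      exact hN0 (LinearMap.ext h)
    obtain ⟨n, hn⟩ := hN
    have hne : ∀ n, (N ^ (n + 1)) x ≠ 0 := by
      intro n
      induction n with
      | zero => simpa using hx
      | succ n ih =>
        rw [pow_succ', Module.End.mul_apply]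
        rw [pow_succ', Module.End.mul_apply] at ih ⊢
        exact H _ ih
    apply hne n
    rw [pow_succ', hn]
    simp
  refine ⟨w / N w, ?_⟩
  have h1 : σ w = w + N w := by simp [N]
  have h2 : σ (N w) = N w := sub_eq_zero.1 hw'
  rw [map_div₀, h2, h1, add_div, div_self hw]

/-- If `L` is algebraically closed of characteristic `p`, then the Artin–Schreier map is
surjective on any subfield over which `L` is finite Galois. -/
theorem IsGalois.exists_pow_sub_self_eq {K : Type*} (L : Type*) [Field K] [Field L] [Algebra K L]
    [FiniteDimensional K L] [IsGalois K L] [IsAlgClosed L] (p : ℕ) [Fact p.Prime] [CharP K p]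
    (a : K) : ∃ b : K, b ^ p - b = a := by
  have : CharP L p := charP_of_injective_algebraMap (algebraMap K L).injective p
  have hp : 1 < p := (Fact.out : p.Prime).one_lt
  obtain ⟨c, rfl⟩ := Algebra.trace_surjective K L a
  obtain ⟨d, hd⟩ := IsAlgClosed.exists_root (X ^ p - (X + C c) : L[X]) (by
    rw [degree_sub_eq_left_of_degree_lt (by
      rw [degree_X_add_C, degree_X_pow]; exact_mod_cast hp), degree_X_pow]
    exact_mod_cast (by omega : p ≠ 0))
  have hd : d ^ p - d = c := by
    simpa [sub_eq_zero, sub_eq_iff_eq_add'] using hd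
  refine ⟨Algebra.trace K L d, (algebraMap K L).injective ?_⟩
  rw [map_sub, map_pow, trace_eq_sum_automorphisms, trace_eq_sum_automorphisms, sum_pow_char,
    ← Finset.sum_sub_distrib]
  simp [← hd]

/-- An algebraically closed field of characteristic `p` is not Galois of degree `p` over any
subfield. -/
theorem IsAlgClosed.finrank_ne_char {K L : Type*} [Field K] [Field L] [Algebra K L]
    [FiniteDimensional K L] [IsGalois K L] [IsAlgClosed L] (p : ℕ) [Fact p.Prime] [CharP K p] :
    finrank K L ≠ p := by
  intro hd
  have : CharP L p := charP_of_injective_algebraMap (algebraMap K L).injective p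
  obtain ⟨σ, hσ, hσp, hfix⟩ := IsGalois.exists_generator_of_finrank_prime Fact.out hd
  obtain ⟨α, hα⟩ := AlgEquiv.exists_apply_eq_add_one p hσ hσp
  obtain ⟨a, ha⟩ := hfix (α ^ p - α) (by
    rw [map_sub, map_pow, hα, add_pow_char, one_pow]; ring)
  obtain ⟨b, rfl⟩ := IsGalois.exists_pow_sub_self_eq L p a
  have hmem : α - algebraMap K L b ∈ (⊥ : Subfield L) := by
    rw [Subfield.mem_bot_iff_pow_eq_self L p, sub_pow_char]
    rw [map_sub, map_pow] at ha
    linear_combination -ha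
  obtain ⟨c, hc⟩ := (bot_le : (⊥ : Subfield L) ≤ (algebraMap K L).fieldRange) hmem
  have hα' : α = algebraMap K L (c + b) := by rw [map_add, hc]; ring
  rw [hα', AlgEquiv.commutes] at hα
  simp at hα

/-- A root of unity of prime order `p` in an extension of degree `p` lies in the base field. -/
theorem IsPrimitiveRoot.mem_range_of_finrank_eq {K L : Type*} [Field K] [Field L] [Algebra K L]
    [FiniteDimensional K L] {p : ℕ} (hp : p.Prime) (hd : finrank K L = p) {ζ : L}
    (hζ : IsPrimitiveRoot ζ p) : ζ ∈ Set.range (algebraMap K L) := by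
  have hint : IsIntegral K ζ := .of_finite K ζ
  have hdvd := minpoly.degree_dvd hint
  rw [hd, Nat.dvd_prime hp] at hdvd
  have hle : (minpoly K ζ).natDegree ≤ p - 1 := by
    rw [← Nat.totient_prime hp, ← natDegree_cyclotomic p K]
    refine natDegree_le_of_dvd (minpoly.dvd K ζ ?_) (cyclotomic_ne_zero p K)
    rw [aeval_def, ← eval_map, map_cyclotomic]
    exact hζ.isRoot_cyclotomic hp.pos
  have := hp.pos
  exact minpoly.natDegree_eq_one_iff.1 (by omega)

/-- An algebraically closed field is not Galois of odd prime degree over any subfield. -/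
theorem IsAlgClosed.eq_two_of_finrank_prime {K L : Type*} [Field K] [Field L] [Algebra K L]
    [FiniteDimensional K L] [IsGalois K L] [IsAlgClosed L] {p : ℕ} (hp : p.Prime)
    (hd : finrank K L = p) : p = 2 := by
  have : Fact p.Prime := ⟨hp⟩
  by_contra hp2
  by_cases hpK : (p : K) = 0
  · have : CharP K p := (CharP.charP_iff_prime_eq_zero hp).2 hpK
    exact IsAlgClosed.finrank_ne_char p hd
  have : NeZero (p : L) := ⟨by
    rwa [← map_natCast (algebraMap K L), Ne, _root_.map_eq_zero]⟩
  obtain ⟨ζ, hζ⟩ := HasEnoughRootsOfUnity.exists_primitiveRoot L p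
  obtain ⟨z, rfl⟩ := hζ.mem_range_of_finrank_eq hp hd
  have hz : IsPrimitiveRoot z p := hζ.of_map_of_injective (algebraMap K L).injective
  have : IsCyclic Gal(L/K) := isCyclic_of_prime_card ((IsGalois.card_aut_eq_finrank K L).trans hd)
  have hroots : (primitiveRoots (finrank K L) K).Nonempty :=
    ⟨z, (mem_primitiveRoots finrank_pos).2 (hd ▸ hz)⟩
  obtain ⟨α, ⟨a, ha⟩, hα⟩ := exists_root_adjoin_eq_top_of_isCyclic K L hroots
  have hirr := irreducible_X_pow_sub_C_of_root_adjoin_eq_top ha.symm hα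
  rw [hd] at hirr
  have hirr2 := X_pow_sub_C_irreducible_of_prime_pow hp hp2 2
    (pow_ne_of_irreducible_X_pow_sub_C hirr dvd_rfl hp.ne_one)
  have hpos : 0 < p ^ 2 := pow_pos hp.pos 2
  obtain ⟨β, hβ⟩ := IsAlgClosed.exists_pow_nat_eq (algebraMap K L a) hpos
  have hmin : minpoly K β = X ^ p ^ 2 - C a :=
    (minpoly.eq_of_irreducible_of_monic hirr2 (by simp [hβ]) (monic_X_pow_sub_C a hpos.ne')).symm
  have hle := minpoly.natDegree_le (A := K) β
  rw [hmin, natDegree_X_pow_sub_C, hd] at hle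
  nlinarith [hp.one_lt]

/-- If an algebraically closed field is quadratic Galois over `K`, then `-1` is not a square
in `K`. -/
theorem IsAlgClosed.sq_ne_neg_one_of_finrank_eq_two {K L : Type*} [Field K] [Field L] [Algebra K L]
    [FiniteDimensional K L] [IsGalois K L] [IsAlgClosed L] (hd : finrank K L = 2) (i : K) :
    i ^ 2 ≠ -1 := by
  intro hi
  by_cases h2 : (2 : K) = 0
  · have : CharP K 2 := (CharP.charP_iff_prime_eq_zero Nat.prime_two).2 (by exact_mod_cast h2)
    exact IsAlgClosed.finrank_ne_char 2 hd
  obtain ⟨σ, hσ, hσ2, hfix⟩ := IsGalois.exists_generator_of_finrank_prime Nat.prime_two hd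
  have hinv : ∀ x, σ (σ x) = x := fun x => by
    simpa [pow_two] using DFunLike.congr_fun hσ2 x
  obtain ⟨γ, hγ⟩ : ∃ γ, σ γ ≠ γ := by
    by_contra! h
    exact hσ (AlgEquiv.ext h)
  obtain ⟨β, hβ⟩ := IsAlgClosed.exists_pow_nat_eq (σ γ - γ) two_pos
  obtain ⟨c, hc⟩ := hfix (β * σ β) (by rw [map_mul, hinv, mul_comm])
  have hi' : (algebraMap K L i) ^ 2 = -1 := by rw [← map_pow, hi]; simp
  have hσβ : (σ β) ^ 2 = -(σ γ - γ) := by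
    rw [← map_pow, hβ, map_sub, hinv]; ring
  have hsq : (algebraMap K L c) ^ 2 = (algebraMap K L i * (σ γ - γ)) ^ 2 := by
    rw [hc, mul_pow, mul_pow, hσβ, hβ, hi']; ring
  have hanti : σ (algebraMap K L i * (σ γ - γ)) = -(algebraMap K L i * (σ γ - γ)) := by
    rw [map_mul, AlgEquiv.commutes, map_sub, hinv]; ring
  have hinvar : σ (algebraMap K L i * (σ γ - γ)) = algebraMap K L i * (σ γ - γ) := by
    rcases sq_eq_sq_iff_eq_or_eq_neg.1 hsq with h | h
    · rw [← h, AlgEquiv.commutes]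
    · rw [← neg_eq_iff_eq_neg] at h
      rw [← h, map_neg, AlgEquiv.commutes]
  have h2L : (2 : L) ≠ 0 := by
    rw [← map_ofNat (algebraMap K L) 2]
    exact (_root_.map_ne_zero _).2 h2
  have hi0 : algebraMap K L i ≠ 0 := by
    intro h
    simp [h] at hi'
  have : 2 * (algebraMap K L i * (σ γ - γ)) = 0 := by
    linear_combination hanti - hinvar
  simp [h2L, hi0, sub_eq_zero, hγ] at this

/-- A field containing a square root of `-1` has no nontrivial finite Galois extension that is
algebraically closed. -/
theorem IsAlgClosed.finrank_eq_one_of_sq_eq_neg_one {K L : Type*} [Field K] [Field L] [Algebra K L]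
    [FiniteDimensional K L] [IsGalois K L] [IsAlgClosed L] {i : K} (hi : i ^ 2 = -1) :
    finrank K L = 1 := by
  by_contra hne
  obtain ⟨p, hp, hdvd⟩ := Nat.exists_prime_and_dvd hne
  have : Fact p.Prime := ⟨hp⟩
  rw [← IsGalois.card_aut_eq_finrank] at hdvd
  obtain ⟨σ, hσ⟩ := exists_prime_orderOf_dvd_card' p hdvd
  have hd : finrank (fixedField (Subgroup.zpowers σ)) L = p := by
    rw [finrank_fixedField_eq_card, Nat.card_zpowers, hσ]
  obtain rfl := IsAlgClosed.eq_two_of_finrank_prime hp hd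
  refine IsAlgClosed.sq_ne_neg_one_of_finrank_eq_two hd
    (algebraMap K (fixedField (Subgroup.zpowers σ)) i) ?_
  rw [← map_pow, hi, map_neg, map_one]

/-- If an algebraically closed field is a nontrivial finite Galois extension of `K`, then it has
degree two over `K`. -/
theorem IsAlgClosed.finrank_eq_two {K L : Type*} [Field K] [Field L] [Algebra K L]
    [FiniteDimensional K L] [IsGalois K L] [IsAlgClosed L] (hne : finrank K L ≠ 1) :
    finrank K L = 2 := by
  obtain ⟨i, hi⟩ := IsAlgClosed.exists_pow_nat_eq (-1 : L) two_pos
  have htop : finrank K⟮i⟯ L = 1 :=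
    IsAlgClosed.finrank_eq_one_of_sq_eq_neg_one (i := AdjoinSimple.gen K i)
      (Subtype.ext (by simpa using hi))
  have hmul := finrank_mul_finrank K K⟮i⟯ L
  rw [htop, mul_one, adjoin.finrank (.of_finite K i)] at hmul
  have hle : (minpoly K i).natDegree ≤ 2 := by
    have hdeg : (X ^ 2 + C 1 : K[X]).natDegree = 2 := by compute_degree!
    have h0 : (X ^ 2 + C 1 : K[X]) ≠ 0 := ne_zero_of_natDegree_gt (n := 1) (by omega)
    rw [← hdeg]
    exact natDegree_le_of_dvd (minpoly.dvd K i (by simp [hi])) h0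
  have := finrank_pos (R := K) (M := L)
  omega

/-- A field over which an algebraically closed field is quadratic Galois has characteristic
zero. -/
theorem IsAlgClosed.ringChar_eq_zero_of_finrank_eq_two {K L : Type*} [Field K] [Field L]
    [Algebra K L] [FiniteDimensional K L] [IsGalois K L] [IsAlgClosed L] (hd : finrank K L = 2) :
    ringChar K = 0 := by
  by_contra hchar
  have : NeZero (ringChar K) := ⟨hchar⟩
  have hK := IsAlgClosed.sq_ne_neg_one_of_finrank_eq_two (K := K) hd
  obtain ⟨a, b, hab⟩ := CharP.sq_add_sq K (ringChar K) (-1)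
  obtain ⟨i, hi⟩ := IsAlgClosed.exists_pow_nat_eq (-1 : L) two_pos
  obtain ⟨σ, hσ, hσ2, hfix⟩ := IsGalois.exists_generator_of_finrank_prime Nat.prime_two hd
  have hinv : ∀ x, σ (σ x) = x := fun x => by
    simpa [pow_two] using DFunLike.congr_fun hσ2 x
  have hσi : σ i = -i := by
    have hsq : (σ i) ^ 2 = i ^ 2 := by rw [← map_pow, hi, map_neg, map_one]
    refine (sq_eq_sq_iff_eq_or_eq_neg.1 hsq).resolve_left fun h => ?_
    obtain ⟨j, rfl⟩ := hfix i h
    exact hK j ((algebraMap K L).injective (by rw [map_pow, hi, map_neg, map_one]))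
  obtain ⟨w, hw⟩ := IsAlgClosed.exists_pow_nat_eq (a + b * i : L) two_pos
  obtain ⟨c, hc⟩ := hfix (w * σ w) (by rw [map_mul, hinv, mul_comm])
  refine hK c ((algebraMap K L).injective ?_)
  have habL := congrArg (algebraMap K L) hab
  simp only [map_add, map_pow, map_natCast, map_intCast] at habL
  have hσw : (σ w) ^ 2 = a - b * i := by
    rw [← map_pow, hw, map_add, map_mul, map_natCast, map_natCast, hσi]; ring
  rw [map_pow, hc, mul_pow, hw, hσw, map_neg, map_one]
  push_cast at habL
  linear_combination habL - (b : L) ^ 2 * hi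

/-- A finite extension whose top field is perfect is separable. -/
theorem Algebra.IsSeparable.of_finite_of_perfectField (K L : Type*) [Field K] [Field L]
    [Algebra K L] [FiniteDimensional K L] [PerfectField L] : Algebra.IsSeparable K L := by
  obtain ⟨p, hp⟩ := ExpChar.exists K
  have : ExpChar L p := expChar_of_injective_algebraMap (algebraMap K L).injective p
  have : ExpChar (separableClosure K L) p :=
    expChar_of_injective_algebraMap (algebraMap K (separableClosure K L)).injective p
  refine (separableClosure.eq_top_iff K L).1 (_root_.eq_top_iff.2 fun x _ => ?_)
  obtain ⟨y, rfl⟩ := (bijective_iterateFrobenius L p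
    (n := IsPurelyInseparable.exponent (separableClosure K L) L)).surjective x
  obtain ⟨z, hz⟩ := IsPurelyInseparable.exponent_def' (separableClosure K L) p y
  rw [iterateFrobenius_def, ← hz]
  exact z.2

/-- If `F` is a field that is not algebraically closed, then either its
algebraic closure is infinite-dimensional over `F`, or `[F̄ : F] = 2` and `F` has
characteristic `0`.  In particular, if `F` has nonzero characteristic and is not
algebraically closed then `[F̄ : F]` is infinite. -/
theorem artin_schreier_consequence (F : Type*) [Field F] (h : ¬ IsAlgClosed F) :
    (¬ Module.Finite F (AlgebraicClosure F) ∨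
      (Module.finrank F (AlgebraicClosure F) = 2 ∧ ringChar F = 0)) ∧
    (ringChar F ≠ 0 → ¬ Module.Finite F (AlgebraicClosure F)) := by
  have key : Module.Finite F (AlgebraicClosure F) →
      Module.finrank F (AlgebraicClosure F) = 2 ∧ ringChar F = 0 := by
    intro hfin
    have := Algebra.IsSeparable.of_finite_of_perfectField F (AlgebraicClosure F)
    have := IsAlgClosure.normal F (AlgebraicClosure F)
    have : IsGalois F (AlgebraicClosure F) := ⟨⟩
    have hne : finrank F (AlgebraicClosure F) ≠ 1 := by
      intro h1
      have hbij : Function.Bijective (algebraMap F (AlgebraicClosure F)) :=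
        Algebra.finrank_eq_one_iff_bijective_algebraMap.1 h1
      exact h (IsAlgClosed.of_ringEquiv _ _ (RingEquiv.ofBijective _ hbij).symm)
    have hd := IsAlgClosed.finrank_eq_two hne
    exact ⟨hd, IsAlgClosed.ringChar_eq_zero_of_finrank_eq_two hd⟩
  exact ⟨not_or_of_imp key, fun hchar hfin => hchar (key hfin).2⟩
end

section
/- Let $L$ be a finite-dimensional restricted Lie algebra over a field $F$ of characteristic $p > 0$, and let $C$ be a simple character cluster of $L$. Then the $C$-reduced enveloping algebra $u(L,C)$ is a finite-dimensional associative $F$-algebra, and any composition factor of $u(L,C)$ regarded as an $L$-module is a finite-dimensional irreducible $L$-module with character cluster $C$. In particular, for any simple cluster $C$ there exists a finite-dimensional irreducible $L$-module with cluster $C$. -/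
open Polynomial

/-- A `p`-operation making a Lie algebra `L` over `F` into a restricted Lie algebra:
`ad (x^[p]) = (ad x)^p`, `(t • x)^[p] = t^p • x^[p]`, and Jacobson's formula for
`(x+y)^[p]`, the latter expressed equivalently as additivity of
`x ↦ ι(x)^p - ι(x^[p])` in the universal enveloping algebra. -/
structure POperation (F L : Type) [Field F] [LieRing L] [LieAlgebra F L] (p : ℕ) where
  pOp : L → L
  ad_pow : ∀ x : L, (LieAlgebra.ad F L x) ^ p = LieAlgebra.ad F L (pOp x)
  smul_pow : ∀ (t : F) (x : L), pOp (t • x) = t ^ p • pOp x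
  jacobson : ∀ x y : L,
    (UniversalEnvelopingAlgebra.ι F (x + y)) ^ p
        - UniversalEnvelopingAlgebra.ι F (pOp (x + y)) =
      ((UniversalEnvelopingAlgebra.ι F x) ^ p - UniversalEnvelopingAlgebra.ι F (pOp x)) +
        ((UniversalEnvelopingAlgebra.ι F y) ^ p - UniversalEnvelopingAlgebra.ι F (pOp y))

variable {F L : Type} [Field F] [LieRing L] [LieAlgebra F L] {p : ℕ}

/-- A generalised character of `L` is an `F`-linear map `L → F̄`.  A character cluster
`C` is *simple* if it is a nonempty Galois-conjugation-closed set of generalised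
characters whose members are all conjugate. -/
def IsSimpleCluster (C : Set (L →ₗ[F] AlgebraicClosure F)) : Prop :=
  C.Nonempty ∧
  (∀ c ∈ C, ∀ σ : AlgebraicClosure F ≃ₐ[F] AlgebraicClosure F, σ.toLinearMap ∘ₗ c ∈ C) ∧
  (∀ c ∈ C, ∀ c' ∈ C, ∃ σ : AlgebraicClosure F ≃ₐ[F] AlgebraicClosure F,
    c' = σ.toLinearMap ∘ₗ c)

/-- The central operator by which `x^p - x^[p]` acts on an `L`-module `V`. -/
noncomputable def centralOp (P : POperation F L p)
    (V : Type) [AddCommGroup V] [Module F V] [LieRingModule L V] [LieModule F L V]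
    (x : L) : Module.End F V :=
  (LieModule.toEnd F L V x) ^ p - LieModule.toEnd F L V (P.pOp x)

/-- `V` has character cluster `C`: for each `x ∈ L`, the roots in `F̄` of the minimal
polynomial of the action of the central element `x^p - x^[p]` on `V` are exactly the
values `c(x)^p` for `c ∈ C`.  (For an irreducible module this is equivalent to the
cluster of characters of the composition factors of `F̄ ⊗ V` being `C`.) -/
def HasCluster (P : POperation F L p)
    (V : Type) [AddCommGroup V] [Module F V] [LieRingModule L V] [LieModule F L V]
    (C : Set (L →ₗ[F] AlgebraicClosure F)) : Prop :=
  ∀ x : L, ∀ z : AlgebraicClosure F,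
    aeval z (minpoly F (centralOp P V x)) = 0 ↔ ∃ c ∈ C, z = (c x) ^ p

/-- The defining relations of the `C`-reduced enveloping algebra `u(L, C)`:
`m_x(x^p - x^[p]) = 0` where `m_x` is the minimal polynomial of `c(x)^p` over `F`. -/
def uRel (P : POperation F L p) (c : L →ₗ[F] AlgebraicClosure F)
    (a b : UniversalEnvelopingAlgebra F L) : Prop :=
  b = 0 ∧ ∃ x : L,
    a = aeval ((UniversalEnvelopingAlgebra.ι F x) ^ p
          - UniversalEnvelopingAlgebra.ι F (P.pOp x)) (minpoly F ((c x) ^ p))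

/-- `V` is a `u(L, C)`-module: the relations of `u(L, C)` act as zero on `V`. -/
def IsReducedModule (P : POperation F L p) (c : L →ₗ[F] AlgebraicClosure F)
    (V : Type) [AddCommGroup V] [Module F V] [LieRingModule L V] [LieModule F L V] : Prop :=
  ∀ x : L, aeval (centralOp P V x) (minpoly F ((c x) ^ p)) = 0

/-- A bundled finite-dimensional irreducible `L`-module with character cluster `C`. -/
structure IrredModWithCluster (P : POperation F L p)
    (C : Set (L →ₗ[F] AlgebraicClosure F)) where
  carrier : Type
  [isAddCommGroup : AddCommGroup carrier]
  [isModule : Module F carrier]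
  [isLieRingModule : LieRingModule L carrier]
  [isLieModule : LieModule F L carrier]
  finDim : FiniteDimensional F carrier
  irred : LieModule.IsIrreducible F L carrier
  cluster : HasCluster P carrier C

attribute [instance] IrredModWithCluster.isAddCommGroup IrredModWithCluster.isModule
  IrredModWithCluster.isLieRingModule IrredModWithCluster.isLieModule

section Finiteness

variable {F R κ : Type*} [Field F] [Ring R] [Algebra F R]

theorem prod_sub_prod_mem_pow_of_perm {f : κ → R} {S : Submodule F R} (hS : 1 ≤ S)
    (hf : ∀ i, f i ∈ S) (hcomm : ∀ i j, f i * f j - f j * f i ∈ S) {l₁ l₂ : List κ}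
    (h : l₁.Perm l₂) :
    ∀ N, l₁.length ≤ N + 1 → (l₁.map f).prod - (l₂.map f).prod ∈ S ^ N := by
  have hmono : ∀ {a b : ℕ}, a ≤ b → S ^ a ≤ S ^ b := fun hab => pow_le_pow_right' hS hab
  induction h with
  | nil => intro N _; simp
  | @cons x l₁ l₂ hp ih =>
    intro N hN
    rcases N with _ | N
    · have h0 : l₁.length = 0 := by simpa using hN
      have h1 : l₁ = [] := List.length_eq_zero_iff.mp h0
      subst h1
      rw [List.nil_perm.mp hp]
      simp
    · simp only [List.map_cons, List.prod_cons, ← mul_sub]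
      rw [pow_succ']
      exact Submodule.mul_mem_mul (hf x) (ih N (by simpa using hN))
  | swap x y l =>
    intro N hN
    rcases N with _ | N
    · simp at hN
    · simp only [List.map_cons, List.prod_cons, ← mul_assoc, ← sub_mul]
      rw [pow_succ']
      refine Submodule.mul_mem_mul (hcomm y x) (hmono (a := l.length) (by simpa using hN) ?_)
      clear hN
      induction l with
      | nil => exact pow_zero S ▸ Submodule.one_le.mp le_rfl
      | cons a l ih =>
        simp only [List.map_cons, List.prod_cons, List.length_cons]
        rw [pow_succ']
        exact Submodule.mul_mem_mul (hf a) ih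
  | trans h₁ h₂ ih₁ ih₂ =>
    intro N hN
    rw [← sub_add_sub_cancel]
    exact add_mem (ih₁ N hN) (ih₂ N (h₁.length_eq ▸ hN))

theorem prod_map_mem_pow {f : κ → R} {S : Submodule F R} (hf : ∀ i, f i ∈ S) (l : List κ) :
    (l.map f).prod ∈ S ^ l.length := by
  induction l with
  | nil => exact pow_zero S ▸ Submodule.one_le.mp le_rfl
  | cons a l ih =>
    simp only [List.map_cons, List.prod_cons, List.length_cons]
    rw [pow_succ']
    exact Submodule.mul_mem_mul (hf a) ih

theorem span_range_pow_le_of_forall_prod_mem {f : κ → R} {N : ℕ} {T : Submodule F R}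
    (h : ∀ l : List κ, l.length = N → (l.map f).prod ∈ T) :
    Submodule.span F (Set.range f) ^ N ≤ T := by
  rw [Submodule.span_pow, Submodule.span_le]
  intro x hx
  obtain ⟨g, rfl⟩ := Set.mem_pow.mp hx
  choose k hk using fun i => (g i).2
  have := h (List.ofFn k) (by simp)
  simpa [List.map_ofFn, Function.comp_def, hk] using this

/-- An algebra generated by finitely many elements which commute up to linear terms, and each of
which satisfies a monic relation up to terms of lower order, is finite-dimensional. -/
theorem finite_of_pow_mem_pow [Finite κ] {f : κ → R}
    (hS : 1 ≤ Submodule.span F (Set.range f))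
    (hcomm : ∀ i j, f i * f j - f j * f i ∈ Submodule.span F (Set.range f))
    (q : κ → ℕ) (hq : ∀ i, f i ^ (q i + 1) ∈ Submodule.span F (Set.range f) ^ q i)
    (hadj : Algebra.adjoin F (Set.range f) = ⊤) : Module.Finite F R := by
  classical
  have := Fintype.ofFinite κ
  set S := Submodule.span F (Set.range f) with hSdef
  have hf : ∀ i, f i ∈ S := fun i => Submodule.subset_span ⟨i, rfl⟩
  set N := ∑ i, q i with hN
  have hmono : ∀ {a b : ℕ}, a ≤ b → S ^ a ≤ S ^ b := fun hab => pow_le_pow_right' hS hab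
  have key : S ^ (N + 1) ≤ S ^ N := by
    refine span_range_pow_le_of_forall_prod_mem fun l hl => ?_
    obtain ⟨i, hi⟩ : ∃ i, q i + 1 ≤ l.count i := by
      by_contra! hcon
      have h1 : ∑ i, l.count i ≤ N := Finset.sum_le_sum fun i _ => Nat.lt_succ_iff.mp (hcon i)
      have h2 : ∑ i, l.count i = l.length := by
        simpa using Multiset.sum_count_eq_card (s := Finset.univ) (m := (l : Multiset κ)) (by simp)
      omega
    obtain ⟨t, ht⟩ := (List.replicate_sublist_iff.mpr hi).exists_perm_append
    have h1 := prod_sub_prod_mem_pow_of_perm hS hf hcomm ht N hl.le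
    have h2 : ((List.replicate (q i + 1) i ++ t).map f).prod ∈ S ^ N := by
      have hlen := ht.length_eq
      simp only [List.length_append, List.length_replicate] at hlen
      have : N = q i + t.length := by omega
      rw [this, pow_add]
      simp only [List.map_append, List.map_replicate, List.prod_append, List.prod_replicate]
      exact Submodule.mul_mem_mul (hq i) (prod_map_mem_pow hf t)
    simpa using add_mem h1 h2
  have hall : ∀ n, S ^ n ≤ S ^ N := by
    intro n
    induction n with
    | zero => exact hmono (Nat.zero_le _)
    | succ n ih =>
      calc S ^ (n + 1) = S ^ n * S := pow_succ _ _
        _ ≤ S ^ N * S := by gcongr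
        _ = S ^ (N + 1) := (pow_succ _ _).symm
        _ ≤ S ^ N := key
  have hmulS : S ^ N * S ^ N ≤ S ^ N := by rw [← pow_add]; exact hall _
  have htop : S ^ N = ⊤ := by
    rw [eq_top_iff]
    intro x _
    have hx : x ∈ Algebra.adjoin F (Set.range f) := by rw [hadj]; trivial
    induction hx using Algebra.adjoin_induction with
    | mem x hx => obtain ⟨i, rfl⟩ := hx; exact hall 1 (by simpa using hf i)
    | algebraMap r => exact hmono (Nat.zero_le N) (by simp [Submodule.mem_one])
    | add x y _ _ hx hy => exact add_mem (hx trivial) (hy trivial)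
    | mul x y _ _ hx hy => exact hmulS (Submodule.mul_mem_mul (hx trivial) (hy trivial))
  have hfg : S.FG := Submodule.fg_span (Set.finite_range f)
  exact ⟨htop ▸ hfg.pow N⟩

theorem pow_mem_pow_of_aeval_eq_zero {S : Submodule F R} (hS : 1 ≤ S) {p : ℕ} (hp : 2 ≤ p)
    {e e' : R} (he : e ∈ S) (he' : e' ∈ S) {m : F[X]} (hm : m.Monic) (hd : 0 < m.natDegree)
    (h0 : aeval (e ^ p - e') m = 0) : ∃ q, e ^ (q + 1) ∈ S ^ q := by
  have hmono : ∀ {a b : ℕ}, a ≤ b → S ^ a ≤ S ^ b := fun hab => pow_le_pow_right' hS hab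
  set z := e ^ p - e' with hz
  have hpow : ∀ k, e ^ k ∈ S ^ k := fun k => Submodule.pow_mem_pow S he k
  have hzS : z ∈ S ^ p := sub_mem (hpow p) (hmono (a := 1) (by omega) (by simpa using he'))
  have hsub : ∀ k, z ^ (k + 1) - e ^ (p * (k + 1)) ∈ S ^ (p * (k + 1) - 1) := by
    intro k
    induction k with
    | zero =>
      have : z ^ (0 + 1) - e ^ (p * (0 + 1)) = - e' := by simp [hz]
      rw [this]
      exact neg_mem (hmono (a := 1) (by omega) (by simpa using he'))
    | succ k ih =>
      have : z ^ (k + 1 + 1) - e ^ (p * (k + 1 + 1)) =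
          z * (z ^ (k + 1) - e ^ (p * (k + 1))) + (- e') * e ^ (p * (k + 1)) := by
        rw [pow_succ' z (k + 1), show -e' = z - e ^ p by simp [hz],
          show p * (k + 1 + 1) = p + p * (k + 1) by ring, pow_add e p, mul_sub z,
          sub_mul z (e ^ p)]
        abel
      rw [this]
      have hk : 1 ≤ p * (k + 1) := Nat.mul_pos (by omega) (by omega)
      refine add_mem ?_ ?_
      · have h1 := Submodule.mul_mem_mul hzS ih
        rw [← pow_add] at h1
        exact hmono (by rw [mul_add p (k + 1) 1]; omega) h1
      · have h1 := Submodule.mul_mem_mul (neg_mem he') (hpow (p * (k + 1)))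
        rw [← pow_succ'] at h1
        exact hmono (by rw [mul_add p (k + 1) 1]; omega) h1
  obtain ⟨d, hd'⟩ : ∃ d, m.natDegree = d + 1 := ⟨m.natDegree - 1, by omega⟩
  refine ⟨p * (d + 1) - 1, ?_⟩
  have hpd : p ≤ p * (d + 1) := Nat.le_mul_of_pos_right _ (by omega)
  rw [Nat.sub_add_cancel (by omega)]
  have h1 : z ^ (d + 1) ∈ S ^ (p * (d + 1) - 1) := by
    rw [aeval_eq_sum_range, hd', Finset.sum_range_succ, ← hd', hm.coeff_natDegree, one_smul,
      hd'] at h0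
    rw [eq_neg_of_add_eq_zero_right h0]
    refine neg_mem (Submodule.sum_mem _ fun k hk => Submodule.smul_mem _ _ ?_)
    have hk' : k ≤ d := Nat.lt_succ_iff.mp (Finset.mem_range.mp hk)
    have h2 := Submodule.pow_mem_pow _ hzS k
    rw [← pow_mul] at h2
    refine hmono ?_ h2
    have : p * k ≤ p * d := Nat.mul_le_mul_left _ hk'
    rw [mul_add p d 1]; omega
  have := sub_mem h1 (hsub d)
  simpa using this

end Finiteness

namespace MvPolynomial.PBW

variable {F L K ι : Type*} [Field F] [LieRing L] [LieAlgebra F L] [CommRing K] [Algebra F K]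

variable (K ι) in
/-- The polynomials all of whose monomials have total degree less than `d`. -/
noncomputable def degreeLT (d : ℕ) : Submodule K (MvPolynomial ι K) :=
  restrictSupport K {m | m.degree < d}

theorem degreeLT_mono {a b : ℕ} (h : a ≤ b) : degreeLT K ι a ≤ degreeLT K ι b :=
  restrictSupport_mono K fun _ hm => lt_of_lt_of_le hm h

theorem monomial_mem_degreeLT {d : ℕ} {m : ι →₀ ℕ} (r : K) (h : m.degree < d) :
    monomial m r ∈ degreeLT K ι d :=
  (monomial_mem_restrictSupport K).mpr (Or.inl h)

theorem exists_mem_degreeLT (f : MvPolynomial ι K) : ∃ d, f ∈ degreeLT K ι d :=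
  ⟨f.support.sup Finsupp.degree + 1, fun _ hm => Nat.lt_succ_of_le (Finset.le_sup hm)⟩

theorem eq_zero_of_mem_degreeLT_zero {f : MvPolynomial ι K} (hf : f ∈ degreeLT K ι 0) : f = 0 := by
  rw [← support_eq_empty, Finset.eq_empty_iff_forall_notMem]
  exact fun m hm => Nat.not_lt_zero _ (hf hm)

theorem degreeLT_le_of_monomial {d : ℕ} {W : Submodule K (MvPolynomial ι K)}
    (h : ∀ m : ι →₀ ℕ, m.degree < d → monomial m 1 ∈ W) : degreeLT K ι d ≤ W := by
  rw [degreeLT, restrictSupport_eq_span, Submodule.span_le]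
  rintro _ ⟨m, hm, rfl⟩
  exact h m hm

theorem mul_mem_degreeLT {a b : ℕ} {f g : MvPolynomial ι K} (hf : f ∈ degreeLT K ι (a + 1))
    (hg : g ∈ degreeLT K ι b) : f * g ∈ degreeLT K ι (a + b) := by
  have h : degreeLT K ι (a + 1) * degreeLT K ι b ≤ degreeLT K ι (a + b) := by
    rw [degreeLT, degreeLT, ← restrictSupport_add]
    refine restrictSupport_mono K ?_
    rintro _ ⟨m, hm, n, hn, rfl⟩
    simp only [Set.mem_ofPred_eq, map_add] at *
    omega
  exact h (Submodule.mul_mem_mul hf hg)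

theorem X_mul_monomial_one (i : ι) (a : ι →₀ ℕ) :
    (X i : MvPolynomial ι K) * monomial a 1 = monomial (a + Finsupp.single i 1) 1 := by
  rw [monomial_add_single, pow_one, mul_comm]

theorem constr_monomial {M : Type*} [AddCommGroup M] [Module K M] (g : (ι →₀ ℕ) → M)
    (a : ι →₀ ℕ) : (basisMonomials ι K).constr K g (monomial a 1) = g a :=
  (basisMonomials ι K).constr_basis K g a

theorem X_mem_degreeLT (i : ι) : (X i : MvPolynomial ι K) ∈ degreeLT K ι (1 + 1) :=
  monomial_mem_degreeLT 1 (by simp)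

/-- The operator `T` is multiplication by `s`, of degree at most `k`, up to lower order terms. -/
structure HasSymbol (T : Module.End K (MvPolynomial ι K)) (s : MvPolynomial ι K) (k : ℕ) :
    Prop where
  mem : s ∈ degreeLT K ι (k + 1)
  sub_mem : ∀ d, ∀ f ∈ degreeLT K ι (d + 1), T f - s * f ∈ degreeLT K ι (d + k)

namespace HasSymbol

variable {T T' : Module.End K (MvPolynomial ι K)} {s s' : MvPolynomial ι K} {k k' : ℕ}

theorem of_monomial (hs : s ∈ degreeLT K ι (k + 1))
    (h : ∀ m : ι →₀ ℕ, T (monomial m 1) - s * monomial m 1 ∈ degreeLT K ι (m.degree + k)) :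
    HasSymbol T s k := by
  refine ⟨hs, fun d => ?_⟩
  have : degreeLT K ι (d + 1) ≤
      (degreeLT K ι (d + k)).comap (T - LinearMap.mulLeft K s) :=
    degreeLT_le_of_monomial fun m hm => degreeLT_mono (by omega) (h m)
  exact fun f hf => this hf

theorem apply_mem (h : HasSymbol T s k) {d : ℕ} {f : MvPolynomial ι K}
    (hf : f ∈ degreeLT K ι (d + 1)) : T f ∈ degreeLT K ι (d + k + 1) := by
  have h1 := mul_mem_degreeLT h.mem hf
  rw [← sub_add_cancel (T f) (s * f)]
  exact add_mem (degreeLT_mono (by omega) (h.sub_mem d f hf)) (degreeLT_mono (by omega) h1)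

theorem one : HasSymbol (1 : Module.End K (MvPolynomial ι K)) 1 0 :=
  ⟨monomial_mem_degreeLT 1 (by simp), fun d f _ => by simp⟩

theorem mul (h : HasSymbol T s k) (h' : HasSymbol T' s' k') :
    HasSymbol (T * T') (s * s') (k + k') := by
  refine ⟨degreeLT_mono (by omega) (mul_mem_degreeLT h.mem h'.mem), fun d f hf => ?_⟩
  have : (T * T') f - s * s' * f = (T (T' f) - s * T' f) + s * (T' f - s' * f) := by
    rw [Module.End.mul_apply]; ring
  rw [this]
  exact add_mem (degreeLT_mono (by omega) (h.sub_mem _ _ (h'.apply_mem hf)))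
    (degreeLT_mono (by omega) (mul_mem_degreeLT h.mem (h'.sub_mem d f hf)))

theorem pow (h : HasSymbol T s k) (n : ℕ) : HasSymbol (T ^ n) (s ^ n) (n * k) := by
  induction n with
  | zero => simpa using one
  | succ n ih =>
    rw [pow_succ, pow_succ, add_mul, one_mul]
    exact ih.mul h

end HasSymbol

theorem constr_mem {e : Module.Basis ι F L} {A : ι → Module.End K (MvPolynomial ι K)}
    (hA : ∀ i, HasSymbol (A i) (X i) 1) (x : L) {d : ℕ} {f : MvPolynomial ι K}
    (hf : f ∈ degreeLT K ι (d + 1)) : e.constr F A x f ∈ degreeLT K ι (d + 2) := by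
  have hx : x ∈ Submodule.span F (Set.range e) := by rw [e.span_eq]; trivial
  induction hx using Submodule.span_induction with
  | mem x hx =>
    obtain ⟨i, rfl⟩ := hx
    simpa only [e.constr_basis] using (hA i).apply_mem hf
  | zero => simp
  | add x y _ _ hx hy => rw [map_add]; exact add_mem hx hy
  | smul r x _ hx => rw [map_smul]; exact Submodule.smul_of_tower_mem _ r hx

theorem constr_congr {e : Module.Basis ι F L} {A B : ι → Module.End K (MvPolynomial ι K)}
    {f : MvPolynomial ι K} (h : ∀ i, A i f = B i f) (x : L) :
    e.constr F A x f = e.constr F B x f := by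
  have hx : x ∈ Submodule.span F (Set.range e) := by rw [e.span_eq]; trivial
  induction hx using Submodule.span_induction with
  | mem x hx => obtain ⟨i, rfl⟩ := hx; simpa only [e.constr_basis] using h i
  | zero => simp
  | add x y _ _ hx hy => simp only [map_add, LinearMap.add_apply, hx, hy]
  | smul r x _ hx => simp only [map_smul, LinearMap.smul_apply, hx]

variable [LinearOrder ι]

theorem forall_le_or_exists_eq_add_single (i : ι) (a : ι →₀ ℕ) :
    (∀ k ∈ a.support, i ≤ k) ∨
      ∃ (j : ι) (b : ι →₀ ℕ), j < i ∧ (∀ k ∈ b.support, j ≤ k) ∧ a = b + Finsupp.single j 1 := by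
  by_cases h : ∀ k ∈ a.support, i ≤ k
  · exact Or.inl h
  · push Not at h
    obtain ⟨k, hk, hki⟩ := h
    have hne : a.support.Nonempty := ⟨k, hk⟩
    have hmem := a.support.min'_mem hne
    refine Or.inr ⟨a.support.min' hne, a - Finsupp.single (a.support.min' hne) 1,
      (a.support.min'_le k hk).trans_lt hki, fun l hl => a.support.min'_le l ?_, ?_⟩
    · exact Finsupp.support_tsub hl
    · refine (tsub_add_cancel_of_le ?_).symm
      rw [Finsupp.single_le_iff]
      exact Nat.one_le_iff_ne_zero.mpr (Finsupp.mem_support_iff.mp hmem)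

theorem min'_support_add_single {j : ι} {b : ι →₀ ℕ} (h : ∀ k ∈ b.support, j ≤ k)
    (hne : (b + Finsupp.single j 1).support.Nonempty) :
    (b + Finsupp.single j 1).support.min' hne = j := by
  refine le_antisymm (Finset.min'_le _ _ (by simp)) (Finset.le_min' _ _ _ fun k hk => ?_)
  rcases Finset.mem_union.mp (Finsupp.support_add hk) with hk | hk
  · exact h k hk
  · exact (Finset.mem_singleton.mp (Finsupp.support_single_subset hk)).ge

variable (K) in
/-- Successive approximations to the action of a basis of `L` on polynomials: the `n`-th one is
exact on polynomials of degree at most `n`. -/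
noncomputable def approx (e : Module.Basis ι F L) :
    ℕ → ι → Module.End K (MvPolynomial ι K)
  | 0 => fun i => LinearMap.mulLeft K (X i)
  | n + 1 => fun i => (basisMonomials ι K).constr K fun a =>
      if h : a.support.Nonempty ∧ ∃ j ∈ a.support, j < i then
        let j := a.support.min' h.1
        let b := monomial (a - Finsupp.single j 1) (1 : K)
        X i * monomial a 1 + approx e n j (approx e n i b - X i * b)
          + e.constr F (approx e n) ⁅e i, e j⁆ b
      else X i * monomial a 1

variable (e : Module.Basis ι F L)

theorem approx_of_le (n : ℕ) {i : ι} {a : ι →₀ ℕ} (h : ∀ k ∈ a.support, i ≤ k) :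
    approx K e n i (monomial a 1) = X i * monomial a 1 := by
  cases n with
  | zero => rfl
  | succ n =>
    have h' : ¬ (a.support.Nonempty ∧ ∃ j ∈ a.support, j < i) :=
      fun ⟨_, j, hj, hji⟩ => (h j hj).not_gt hji
    simp only [approx]
    rw [constr_monomial, dif_neg h']

theorem approx_succ_of_lt (n : ℕ) {i j : ι} {b : ι →₀ ℕ} (hji : j < i)
    (h : ∀ k ∈ b.support, j ≤ k) :
    approx K e (n + 1) i (monomial (b + Finsupp.single j 1) 1) =
      X i * monomial (b + Finsupp.single j 1) 1
        + approx K e n j (approx K e n i (monomial b 1) - X i * monomial b 1)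
        + e.constr F (approx K e n) ⁅e i, e j⁆ (monomial b 1) := by
  have h' : (b + Finsupp.single j 1).support.Nonempty ∧
      ∃ k ∈ (b + Finsupp.single j 1).support, k < i := ⟨⟨j, by simp⟩, j, by simp, hji⟩
  simp only [approx]
  rw [constr_monomial, dif_pos h']
  simp only [min'_support_add_single h, add_tsub_cancel_right]

theorem hasSymbol_approx (n : ℕ) (i : ι) : HasSymbol (approx K e n i) (X i) 1 := by
  induction n generalizing i with
  | zero => exact .of_monomial (X_mem_degreeLT i) fun m => by simp [approx]
  | succ n ih =>
    refine .of_monomial (X_mem_degreeLT i) fun a => ?_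
    rcases forall_le_or_exists_eq_add_single i a with h | ⟨j, b, hji, hb, rfl⟩
    · rw [approx_of_le e _ h, sub_self]
      exact zero_mem _
    · rw [approx_succ_of_lt e n hji hb, add_assoc, add_sub_cancel_left]
      have hmem : monomial b (1 : K) ∈ degreeLT K ι (b.degree + 1) :=
        monomial_mem_degreeLT 1 (Nat.lt_succ_self _)
      simp only [map_add, Finsupp.degree_single]
      exact add_mem ((ih j).apply_mem ((ih i).sub_mem _ _ hmem)) (constr_mem ih _ hmem)

theorem approx_succ_eq (n : ℕ) (i : ι) {f : MvPolynomial ι K} (hf : f ∈ degreeLT K ι (n + 1)) :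
    approx K e (n + 1) i f = approx K e n i f := by
  induction n generalizing i f with
  | zero =>
    have : degreeLT K ι (0 + 1) ≤ LinearMap.eqLocus (approx K e (0 + 1) i) (approx K e 0 i) := by
      refine degreeLT_le_of_monomial fun m hm => ?_
      have : m = 0 := (Finsupp.degree_eq_zero_iff m).mp (by simpa using hm)
      subst this
      rw [LinearMap.mem_eqLocus, approx_of_le e _ (by simp), approx_of_le e _ (by simp)]
    exact this hf
  | succ n ih =>
    have : degreeLT K ι (n + 1 + 1) ≤
        LinearMap.eqLocus (approx K e (n + 1 + 1) i) (approx K e (n + 1) i) := by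
      refine degreeLT_le_of_monomial fun a ha => ?_
      rw [LinearMap.mem_eqLocus]
      rcases forall_le_or_exists_eq_add_single i a with h | ⟨j, b, hji, hb, rfl⟩
      · rw [approx_of_le e _ h, approx_of_le e _ h]
      · rw [approx_succ_of_lt e _ hji hb, approx_succ_of_lt e _ hji hb]
        simp only [map_add, Finsupp.degree_single] at ha
        have hmem : monomial b (1 : K) ∈ degreeLT K ι (b.degree + 1) :=
          monomial_mem_degreeLT 1 (Nat.lt_succ_self _)
        have hmem' : monomial b (1 : K) ∈ degreeLT K ι (n + 1) := degreeLT_mono (by omega) hmem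
        rw [ih i hmem', ih j (degreeLT_mono (by omega)
          ((hasSymbol_approx e n i).sub_mem _ _ hmem)), constr_congr fun k => ih k hmem']
    exact this hf

theorem approx_eq_of_le {m n : ℕ} (hmn : n ≤ m) (i : ι) {f : MvPolynomial ι K}
    (hf : f ∈ degreeLT K ι (n + 1)) : approx K e m i f = approx K e n i f := by
  induction m, hmn using Nat.le_induction with
  | base => rfl
  | succ m hm ih => rw [approx_succ_eq e m i (degreeLT_mono (by omega) hf), ih]

variable (K) in
/-- The action of the basis vector `e i` on polynomials. -/
noncomputable def act (i : ι) : Module.End K (MvPolynomial ι K) :=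
  (basisMonomials ι K).constr K fun a => approx K e a.degree i (monomial a 1)

theorem act_eq_approx (n : ℕ) (i : ι) {f : MvPolynomial ι K} (hf : f ∈ degreeLT K ι (n + 1)) :
    act K e i f = approx K e n i f := by
  have : degreeLT K ι (n + 1) ≤ LinearMap.eqLocus (act K e i) (approx K e n i) := by
    refine degreeLT_le_of_monomial fun a ha => ?_
    rw [LinearMap.mem_eqLocus, approx_eq_of_le e (Nat.lt_succ_iff.mp ha) i
      (monomial_mem_degreeLT 1 (Nat.lt_succ_self _)), act, constr_monomial]
  exact this hf

theorem hasSymbol_act (i : ι) : HasSymbol (act K e i) (X i) 1 :=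
  ⟨X_mem_degreeLT i, fun d f hf => by
    rw [act_eq_approx e d i hf]; exact (hasSymbol_approx e d i).sub_mem d f hf⟩

theorem act_of_le {i : ι} {a : ι →₀ ℕ} (h : ∀ k ∈ a.support, i ≤ k) :
    act K e i (monomial a 1) = monomial (a + Finsupp.single i 1) 1 := by
  rw [act_eq_approx e a.degree i (monomial_mem_degreeLT 1 (Nat.lt_succ_self _)),
    approx_of_le e _ h, X_mul_monomial_one]

variable (K) in
/-- The action of `L` on polynomials in a basis of `L`, underlying the
Poincaré-Birkhoff-Witt theorem. -/
noncomputable def rep : L →ₗ[F] Module.End K (MvPolynomial ι K) :=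
  e.constr F (act K e)

@[simp]
theorem rep_basis (i : ι) : rep K e (e i) = act K e i := e.constr_basis F _ i

theorem act_act_of_le {i j : ι} {b : ι →₀ ℕ} (hji : j < i) (h : ∀ k ∈ b.support, j ≤ k) :
    act K e i (act K e j (monomial b 1)) =
      act K e j (act K e i (monomial b 1)) + rep K e ⁅e i, e j⁆ (monomial b 1) := by
  have hmem : monomial b (1 : K) ∈ degreeLT K ι (b.degree + 1) :=
    monomial_mem_degreeLT 1 (Nat.lt_succ_self _)
  have hsub := (hasSymbol_approx e b.degree i).sub_mem _ _ hmem
  have hXb : act K e j (X i * monomial b 1) = X i * monomial (b + Finsupp.single j 1) 1 := by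
    rw [X_mul_monomial_one, act_of_le, X_mul_monomial_one, add_right_comm]
    intro k hk
    rcases Finset.mem_union.mp (Finsupp.support_add hk) with hk | hk
    · exact h k hk
    · rw [Finset.mem_singleton.mp (Finsupp.support_single_subset hk)]
      exact hji.le
  rw [act_of_le e h, act_eq_approx e (b.degree + 1) i (monomial_mem_degreeLT 1 (by simp)),
    approx_succ_of_lt e _ hji h, ← act_eq_approx e b.degree j hsub,
    ← act_eq_approx e b.degree i hmem, map_sub, hXb, rep,
    constr_congr fun k => (act_eq_approx e b.degree k hmem).symm]
  abel

theorem act_comm_of_lt {d : ℕ}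
    (ih : ∀ x y : L, ∀ f ∈ degreeLT K ι d,
      rep K e x (rep K e y f) = rep K e y (rep K e x f) + rep K e ⁅x, y⁆ f)
    {i j : ι} (hji : j < i) {a : ι →₀ ℕ} (ha : a.degree ≤ d) :
    act K e i (act K e j (monomial a 1)) =
      act K e j (act K e i (monomial a 1)) + rep K e ⁅e i, e j⁆ (monomial a 1) := by
  rcases forall_le_or_exists_eq_add_single j a with h | ⟨k, b, hkj, hb, rfl⟩
  · exact act_act_of_le e hji h
  simp only [map_add, Finsupp.degree_single] at ha
  have hmem : monomial b (1 : K) ∈ degreeLT K ι (b.degree + 1) :=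
    monomial_mem_degreeLT 1 (Nat.lt_succ_self _)
  have hmem' : monomial b (1 : K) ∈ degreeLT K ι d := degreeLT_mono ha hmem
  have aux : ∀ {s t : ι}, k < s → k < t →
      act K e s (act K e k (act K e t (monomial b 1))) =
        act K e k (act K e s (act K e t (monomial b 1)))
          + rep K e ⁅e s, e k⁆ (act K e t (monomial b 1)) := by
    intro s t hs ht
    have h1 : act K e s (act K e k (X t * monomial b 1)) =
        act K e k (act K e s (X t * monomial b 1)) + rep K e ⁅e s, e k⁆ (X t * monomial b 1) := by
      rw [X_mul_monomial_one]
      refine act_act_of_le e hs fun l hl => ?_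
      rcases Finset.mem_union.mp (Finsupp.support_add hl) with hl | hl
      · exact hb l hl
      · rw [Finset.mem_singleton.mp (Finsupp.support_single_subset hl)]
        exact ht.le
    have h2 := ih (e s) (e k) _
      (degreeLT_mono (by omega) ((hasSymbol_act e t).sub_mem _ _ hmem))
    simp only [rep_basis, map_sub, sub_eq_iff_eq_add, h1] at h2
    rw [h2]
    abel
  have hi : k < i := hkj.trans hji
  rw [← act_of_le e hb, act_act_of_le e hkj hb, act_act_of_le e hi hb, map_add, map_add,
    aux hi hkj, aux hkj hi]
  have h1 := ih (e i) (e j) _ hmem'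
  have h2 := ih (e i) ⁅e j, e k⁆ _ hmem'
  have h3 := ih (e j) ⁅e i, e k⁆ _ hmem'
  have h4 := ih ⁅e i, e j⁆ (e k) _ hmem'
  simp only [rep_basis] at h1 h2 h3 h4
  rw [h1, h2, h3, h4, lie_lie (e i) (e j) (e k), map_add, map_sub]
  simp only [LinearMap.sub_apply]
  abel

theorem rep_rep (x y : L) (f : MvPolynomial ι K) :
    rep K e x (rep K e y f) = rep K e y (rep K e x f) + rep K e ⁅x, y⁆ f := by
  suffices h : ∀ d, ∀ x y : L, ∀ f ∈ degreeLT K ι d,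
      rep K e x (rep K e y f) = rep K e y (rep K e x f) + rep K e ⁅x, y⁆ f by
    obtain ⟨d, hd⟩ := exists_mem_degreeLT f
    exact h d x y f hd
  intro d
  induction d with
  | zero => intro x y f hf; simp [eq_zero_of_mem_degreeLT_zero hf]
  | succ d ih =>
    have hb : ∀ i j, ∀ f ∈ degreeLT K ι (d + 1), rep K e (e i) (rep K e (e j) f) =
        rep K e (e j) (rep K e (e i) f) + rep K e ⁅e i, e j⁆ f := by
      intro i j
      have : degreeLT K ι (d + 1) ≤ LinearMap.eqLocus (rep K e (e i) * rep K e (e j))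
          (rep K e (e j) * rep K e (e i) + rep K e ⁅e i, e j⁆) := by
        refine degreeLT_le_of_monomial fun a ha => ?_
        have ha' : a.degree ≤ d := Nat.lt_succ_iff.mp ha
        rw [LinearMap.mem_eqLocus]
        simp only [rep_basis, LinearMap.add_apply, Module.End.mul_apply]
        rcases lt_trichotomy i j with hij | rfl | hij
        · rw [act_comm_of_lt e ih hij ha', ← lie_skew (e i) (e j), map_neg]
          simp
        · simp
        · exact act_comm_of_lt e ih hij ha'
      exact fun f hf => this hf
    intro x y f hf
    have hx : x ∈ Submodule.span F (Set.range e) := by rw [e.span_eq]; trivial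
    have hy : y ∈ Submodule.span F (Set.range e) := by rw [e.span_eq]; trivial
    induction hx using Submodule.span_induction with
    | mem x hx =>
      obtain ⟨i, rfl⟩ := hx
      induction hy using Submodule.span_induction with
      | mem y hy => obtain ⟨j, rfl⟩ := hy; exact hb i j f hf
      | zero => simp
      | add y z _ _ hy hz =>
        simp only [map_add, LinearMap.add_apply, lie_add, hy, hz]; abel
      | smul r y _ hy =>
        simp only [map_smul, LinearMap.smul_apply, lie_smul, LinearMap.map_smul_of_tower, hy,
          smul_add]
    | zero => simp
    | add x z _ _ hx hz =>
      simp only [map_add, LinearMap.add_apply, add_lie, hx, hz]; abel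
    | smul r x _ hx =>
      simp only [map_smul, LinearMap.smul_apply, smul_lie, LinearMap.map_smul_of_tower, hx,
        smul_add]

end MvPolynomial.PBW

namespace MvPolynomial.PBW

variable {K ι : Type*} [CommRing K]

theorem exists_algHom_of_commute {E : Type*} [Ring E] [Algebra K E] (T : ι → E)
    (hT : ∀ i j, T i * T j = T j * T i) :
    ∃ φ : MvPolynomial ι K →ₐ[K] E, ∀ i, φ (X i) = T i := by
  have hcomm : ∀ a ∈ Set.range T, ∀ b ∈ Set.range T, a * b = b * a := by
    rintro _ ⟨i, rfl⟩ _ ⟨j, rfl⟩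
    exact hT i j
  let _ : CommRing (Algebra.adjoin K (Set.range T)) :=
    { mul_comm := fun a b => by
        have := Algebra.isMulCommutative_adjoin K hcomm
        exact setLike_mul_comm a.2 b.2 |> Subtype.ext }
  refine ⟨(Algebra.adjoin K (Set.range T)).val.comp
    (aeval fun i => ⟨T i, Algebra.subset_adjoin ⟨i, rfl⟩⟩), fun i => ?_⟩
  rw [AlgHom.comp_apply, aeval_X]
  rfl

/-- The linear endomorphism sending `X ^ (a + p b)`, where all entries of `a` are less than `p`,
to `φ (X ^ b)` applied to `X ^ a`. -/
noncomputable def twist (p : ℕ) (φ : MvPolynomial ι K →ₐ[K] Module.End K (MvPolynomial ι K)) :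
    Module.End K (MvPolynomial ι K) :=
  (basisMonomials ι K).constr K fun m =>
    φ (monomial (m.mapRange (· / p) (Nat.zero_div p)) 1)
      (monomial (m.mapRange (· % p) (Nat.zero_mod p)) 1)

variable {p : ℕ} {φ : MvPolynomial ι K →ₐ[K] Module.End K (MvPolynomial ι K)}

theorem mapRange_mod_add_smul_div (m : ι →₀ ℕ) :
    m.mapRange (· % p) (Nat.zero_mod p) + p • m.mapRange (· / p) (Nat.zero_div p) = m := by
  ext i
  simp [Nat.mod_add_div]

theorem twist_monomial (m : ι →₀ ℕ) :
    twist p φ (monomial m 1) = φ (monomial (m.mapRange (· / p) (Nat.zero_div p)) 1)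
      (monomial (m.mapRange (· % p) (Nat.zero_mod p)) 1) :=
  constr_monomial _ m

theorem twist_X_pow_mul (hp : 0 < p) (i : ι) (f : MvPolynomial ι K) :
    twist p φ (X i ^ p * f) = φ (X i) (twist p φ f) := by
  have : twist p φ * LinearMap.mulLeft K (X i ^ p) = φ (X i) * twist p φ := by
    refine (basisMonomials ι K).ext fun m => ?_
    have hdiv : (Finsupp.single i p + m).mapRange (· / p) (Nat.zero_div p) =
        m.mapRange (· / p) (Nat.zero_div p) + Finsupp.single i 1 := by
      ext k
      rcases eq_or_ne i k with rfl | hk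
      · simp [Nat.add_div_left _ hp]
      · simp [Finsupp.single_eq_of_ne' hk]
    have hmod : (Finsupp.single i p + m).mapRange (· % p) (Nat.zero_mod p) =
        m.mapRange (· % p) (Nat.zero_mod p) := by
      ext k
      rcases eq_or_ne i k with rfl | hk
      · simp
      · simp [Finsupp.single_eq_of_ne' hk]
    rw [coe_basisMonomials, Module.End.mul_apply, Module.End.mul_apply, LinearMap.mulLeft_apply,
      ← monomial_single_add, twist_monomial, twist_monomial, ← Module.End.mul_apply, ← map_mul,
      X_mul_monomial_one, hdiv, hmod]
  exact LinearMap.congr_fun this f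

theorem twist_one : twist p φ 1 = 1 := by
  have h := twist_monomial (p := p) (φ := φ) 0
  simpa using h

theorem hasSymbol_map_monomial (h : ∀ i, HasSymbol (φ (X i)) (X i ^ p) p) (b : ι →₀ ℕ) :
    HasSymbol (φ (monomial b 1)) (monomial (p • b) 1) (b.degree * p) := by
  induction b using Finsupp.induction_linear with
  | zero => simpa using HasSymbol.one
  | add a b ha hb =>
    have := ha.mul hb
    rwa [← map_mul, monomial_mul, monomial_mul, one_mul, ← smul_add, ← add_mul, ← map_add] at this
  | single i n =>
    have := (h i).pow n
    rw [← map_pow, X_pow_eq_monomial] at this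
    simpa [X_pow_eq_monomial, monomial_pow, mul_comm] using this

theorem twist_sub_mem (h : ∀ i, HasSymbol (φ (X i)) (X i ^ p) p) {d : ℕ}
    {f : MvPolynomial ι K} (hf : f ∈ degreeLT K ι (d + 1)) :
    twist p φ f - f ∈ degreeLT K ι d := by
  have : degreeLT K ι (d + 1) ≤ (degreeLT K ι d).comap (twist p φ - 1) := by
    refine degreeLT_le_of_monomial fun m hm => ?_
    have h1 := (hasSymbol_map_monomial h (m.mapRange (· / p) (Nat.zero_div p))).sub_mem _ _
      (monomial_mem_degreeLT (1 : K)
        (Nat.lt_succ_self (m.mapRange (· % p) (Nat.zero_mod p)).degree))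
    have hdeg := congrArg Finsupp.degree (mapRange_mod_add_smul_div (p := p) m)
    rw [map_add, map_nsmul, smul_eq_mul, mul_comm] at hdeg
    rw [monomial_mul, one_mul, add_comm (p • _), mapRange_mod_add_smul_div, hdeg] at h1
    rw [Submodule.mem_comap, LinearMap.sub_apply, twist_monomial]
    exact degreeLT_mono (Nat.lt_succ_iff.mp hm) h1
  exact this hf

theorem twist_bijective (h : ∀ i, HasSymbol (φ (X i)) (X i ^ p) p) :
    Function.Bijective (twist p φ) := by
  constructor
  · rw [← LinearMap.ker_eq_bot, LinearMap.ker_eq_bot']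
    intro f hf
    obtain ⟨d, hd⟩ := exists_mem_degreeLT f
    induction d with
    | zero => exact eq_zero_of_mem_degreeLT_zero hd
    | succ d ih =>
      refine ih ?_
      have := twist_sub_mem h hd
      rwa [hf, zero_sub, neg_mem_iff] at this
  · intro f
    obtain ⟨d, hd⟩ := exists_mem_degreeLT f
    induction d generalizing f with
    | zero => exact ⟨0, by rw [eq_zero_of_mem_degreeLT_zero hd, map_zero]⟩
    | succ d ih =>
      obtain ⟨g, hg⟩ := ih _ (twist_sub_mem h hd)
      exact ⟨f - g, by rw [map_sub, hg, sub_sub_cancel]⟩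

theorem iSup_range_sub_ne_top [Nontrivial K] (hp : 0 < p)
    {T : ι → Module.End K (MvPolynomial ι K)} (hT : ∀ i j, T i * T j = T j * T i)
    (h : ∀ i, HasSymbol (T i) (X i ^ p) p) (a : ι → K) :
    ⨆ i, LinearMap.range (T i - algebraMap K _ (a i ^ p)) ≠ ⊤ := by
  obtain ⟨φ, hφ⟩ := exists_algHom_of_commute (K := K) T hT
  have h' : ∀ i, HasSymbol (φ (X i)) (X i ^ p) p := fun i => (hφ i).symm ▸ h i
  let Ψ := LinearEquiv.ofBijective (twist p φ) (twist_bijective h')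
  let θ : MvPolynomial ι K →ₗ[K] K := (aeval a).toLinearMap ∘ₗ Ψ.symm.toLinearMap
  have hθ : ∀ f, θ (twist p φ f) = aeval a f := fun f =>
    congrArg (aeval a) (Ψ.symm_apply_apply f)
  have hle : ⨆ i, LinearMap.range (T i - algebraMap K _ (a i ^ p)) ≤ LinearMap.ker θ := by
    refine iSup_le fun i => ?_
    rintro _ ⟨f, rfl⟩
    obtain ⟨g, rfl⟩ := (twist_bijective h').2 f
    rw [LinearMap.mem_ker, LinearMap.sub_apply, map_sub, ← hφ i, ← twist_X_pow_mul hp, hθ,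
      Module.algebraMap_end_apply, map_smul, hθ]
    simp
  intro htop
  rw [htop, top_le_iff] at hle
  have h1 : θ 1 = 0 := by rw [← LinearMap.mem_ker, hle]; trivial
  rw [← twist_one (p := p) (φ := φ), hθ, map_one] at h1
  exact one_ne_zero h1

end MvPolynomial.PBW

section Commutator

variable {A : Type*} [Ring A] {p : ℕ}

theorem pow_mul_sub_mul_pow_eq_iterate [Fact p.Prime] (R : Type*) [CommRing R] [CharP R p]
    [Algebra R A] (a b : A) :
    a ^ p * b - b * a ^ p = ((LinearMap.mulLeft R a - LinearMap.mulRight R a) ^ p) b := by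
  have hzero : (p : Module.End R A) = 0 := by
    rw [← map_natCast (algebraMap R (Module.End R A)), CharP.cast_eq_zero, map_zero]
  rcases subsingleton_or_nontrivial (Module.End R A) with hsub | hnon
  · have : Subsingleton A := by
      refine ⟨fun x y => ?_⟩
      exact (LinearMap.congr_fun (Subsingleton.elim (1 : Module.End R A) 0) x).trans
        (LinearMap.congr_fun (Subsingleton.elim (0 : Module.End R A) 1) y)
    exact Subsingleton.elim _ _
  · have : CharP (Module.End R A) p := (CharP.charP_iff_prime_eq_zero Fact.out).mpr hzero
    rw [sub_pow_char_of_commute _ (LinearMap.commute_mulLeft_right (R := R) a a),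
      LinearMap.pow_mulLeft, LinearMap.pow_mulRight]
    simp

end Commutator

namespace POperation

attribute [local instance] LieRing.ofAssociativeRing

variable (P : POperation F L p) {A : Type*} [Ring A] [Algebra F A] (f : L →ₗ⁅F⁆ A)

/-- The image of `x ^ p - x ^ [p]` under a representation `f` of `L` in an associative algebra. -/
def central (x : L) : A := f x ^ p - f (P.pOp x)

theorem central_eq_lift (x : L) :
    P.central f x = UniversalEnvelopingAlgebra.lift F f
      (UniversalEnvelopingAlgebra.ι F x ^ p - UniversalEnvelopingAlgebra.ι F (P.pOp x)) := by
  rw [map_sub, map_pow, UniversalEnvelopingAlgebra.lift_ι_apply,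
    UniversalEnvelopingAlgebra.lift_ι_apply, central]

theorem central_add (x y : L) : P.central f (x + y) = P.central f x + P.central f y := by
  rw [central_eq_lift, P.jacobson, map_add, ← central_eq_lift, ← central_eq_lift]

theorem central_smul (t : F) (x : L) : P.central f (t • x) = t ^ p • P.central f x := by
  rw [central, central, P.smul_pow, map_smul, map_smul, _root_.smul_pow, smul_sub]

theorem central_commute [Fact p.Prime] [CharP F p] (x y : L) :
    P.central f x * f y = f y * P.central f x := by
  have h : ∀ n : ℕ, ((LinearMap.mulLeft F (f x) - LinearMap.mulRight F (f x)) ^ n) (f y) =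
      f (((LieAlgebra.ad F L x) ^ n) y) := by
    intro n
    induction n with
    | zero => simp
    | succ n ih =>
      rw [pow_succ', Module.End.mul_apply, ih, pow_succ', Module.End.mul_apply,
        LieAlgebra.ad_apply, LieHom.map_lie, LieRing.of_associative_ring_bracket]
      rfl
  have h1 := pow_mul_sub_mul_pow_eq_iterate (p := p) F (f x) (f y)
  rw [h p, P.ad_pow, LieAlgebra.ad_apply, LieHom.map_lie,
    LieRing.of_associative_ring_bracket] at h1
  rw [central, sub_mul, mul_sub, sub_eq_sub_iff_sub_eq_sub]
  exact h1

theorem central_commute_central [Fact p.Prime] [CharP F p] (x y : L) :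
    P.central f x * P.central f y = P.central f y * P.central f x := by
  have h : ∀ z, Commute (P.central f x) (f z) := P.central_commute f x
  exact ((h y).pow_right p).sub_right (h _)

/-- If `x ^ p - x ^ [p]` acts as the scalar `c x ^ p` for `x` in a basis, then it does so for
all `x`. -/
theorem central_eq_algebraMap [Fact p.Prime] [CharP F p] {K ι : Type*} [Field K] [Algebra F K]
    [Algebra K A] [IsScalarTower F K A] (e : Module.Basis ι F L) (c : L →ₗ[F] K)
    (h : ∀ i, P.central f (e i) = algebraMap K A (c (e i) ^ p)) (x : L) :
    P.central f x = algebraMap K A (c x ^ p) := by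
  have : CharP K p := charP_of_injective_algebraMap (algebraMap F K).injective p
  have hx : x ∈ Submodule.span F (Set.range e) := by rw [e.span_eq]; trivial
  induction hx using Submodule.span_induction with
  | mem x hx => obtain ⟨i, rfl⟩ := hx; exact h i
  | zero =>
    have h0 := P.central_smul f 0 0
    rw [zero_smul, zero_pow (Fact.out : p.Prime).ne_zero, zero_smul] at h0
    rw [h0, map_zero, zero_pow (Fact.out : p.Prime).ne_zero, map_zero]
  | add x y _ _ hx hy => rw [central_add, hx, hy, map_add, add_pow_char, map_add]
  | smul t x _ hx =>
    rw [central_smul, hx, map_smul, _root_.smul_pow, ← algebraMap_smul K (t ^ p) (c x ^ p),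
      smul_eq_mul, map_mul, ← IsScalarTower.algebraMap_apply, Algebra.smul_def]

open MvPolynomial.PBW in
/-- A nonzero representation of `L` over `K` in which each `x ^ p - x ^ [p]` acts as the scalar
`c x ^ p`. -/
theorem exists_lieHom_central_eq [Fact p.Prime] [CharP F p] {K ι : Type} [Field K] [Algebra F K]
    (e : Module.Basis ι F L) (c : L →ₗ[F] K) :
    ∃ (A : Type) (_ : Ring A) (_ : Algebra F A) (_ : Algebra K A) (_ : IsScalarTower F K A)
      (_ : Nontrivial A) (f : L →ₗ⁅F⁆ A), ∀ x, P.central f x = algebraMap K A (c x ^ p) := by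
  classical
  let _ : LinearOrder ι := IsWellOrder.linearOrder WellOrderingRel
  have hp : 1 < p := (Fact.out : p.Prime).one_lt
  let ρ : L →ₗ⁅F⁆ Module.End K (MvPolynomial ι K) :=
    { rep K e with
      map_lie' := fun {x y} => by
        rw [LieRing.of_associative_ring_bracket]
        refine LinearMap.ext fun g => ?_
        have := rep_rep (K := K) e x y g
        exact (sub_eq_of_eq_add' this).symm }
  have hρ : ∀ x, ρ x = rep K e x := fun _ => rfl
  let T : ι → Module.End K (MvPolynomial ι K) := fun i => P.central ρ (e i)
  have hsymb : ∀ i, HasSymbol (T i) (MvPolynomial.X i ^ p) p := by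
    intro i
    have h1 := (hasSymbol_act (K := K) e i).pow p
    rw [mul_one] at h1
    refine ⟨h1.mem, fun d g hg => ?_⟩
    have h2 : T i g = (act K e i ^ p) g - rep K e (P.pOp (e i)) g := by
      rw [← rep_basis]; rfl
    rw [h2, sub_right_comm]
    exact sub_mem (h1.sub_mem d g hg)
      (degreeLT_mono (by omega) (constr_mem (hasSymbol_act e) _ hg))
  set W := ⨆ i, LinearMap.range (T i - algebraMap K _ (c (e i) ^ p)) with hW
  have hWtop : W ≠ ⊤ := iSup_range_sub_ne_top (by omega)
    (fun i j => P.central_commute_central ρ _ _) hsymb fun i => c (e i)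
  have hinv : ∀ x, W ≤ W.comap (ρ x) := by
    intro x
    refine iSup_le fun i => ?_
    rintro _ ⟨g, rfl⟩
    refine Submodule.mem_iSup_of_mem i ⟨ρ x g, ?_⟩
    have := LinearMap.congr_fun (P.central_commute ρ (e i) x) g
    rw [Module.End.mul_apply, Module.End.mul_apply] at this
    simp only [LinearMap.sub_apply, Module.algebraMap_end_apply, map_sub, map_smul]
    rw [← this]
  let σ : L →ₗ⁅F⁆ Module.End K (MvPolynomial ι K ⧸ W) :=
    { toFun := fun x => W.mapQ W (ρ x) (hinv x)
      map_add' := fun x y => by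
        refine Submodule.linearMap_qext _ (LinearMap.ext fun g => ?_)
        simp
      map_smul' := fun t x => by
        refine Submodule.linearMap_qext _ (LinearMap.ext fun g => ?_)
        simp
      map_lie' := fun {x y} => by
        refine Submodule.linearMap_qext _ (LinearMap.ext fun g => ?_)
        simp [LieRing.of_associative_ring_bracket] }
  have hσ : ∀ x g, σ x (W.mkQ g) = W.mkQ (ρ x g) := fun _ _ => rfl
  have hσpow : ∀ n x g, (σ x ^ n) (W.mkQ g) = W.mkQ ((ρ x ^ n) g) := by
    intro n x g
    induction n with
    | zero => rfl
    | succ n ih => rw [pow_succ', pow_succ', Module.End.mul_apply, ih, hσ]; rfl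
  have : Nontrivial (MvPolynomial ι K ⧸ W) := Submodule.Quotient.nontrivial_iff.mpr hWtop
  refine ⟨Module.End K (MvPolynomial ι K ⧸ W), inferInstance, inferInstance, inferInstance,
    inferInstance, inferInstance, σ, P.central_eq_algebraMap σ e c fun i => ?_⟩
  refine Submodule.linearMap_qext _ (LinearMap.ext fun g => ?_)
  rw [LinearMap.comp_apply, LinearMap.comp_apply, central, LinearMap.sub_apply, hσpow, hσ,
    Module.algebraMap_end_apply, ← map_sub, ← map_smul, ← sub_eq_zero, ← map_sub,
    ← LinearMap.mem_ker, Submodule.ker_mkQ]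
  exact Submodule.mem_iSup_of_mem i ⟨g, rfl⟩

theorem central_comp {B : Type*} [Ring B] [Algebra F B] (g : A →ₐ[F] B) (x : L) :
    P.central ((g : A →ₗ⁅F⁆ B).comp f) x = g (P.central f x) := by
  simp [central]

theorem lift_eq_zero_of_uRel {c : L →ₗ[F] AlgebraicClosure F}
    (h : ∀ x, aeval (P.central f x) (minpoly F (c x ^ p)) = 0)
    {a b : UniversalEnvelopingAlgebra F L} (hab : uRel P c a b) :
    UniversalEnvelopingAlgebra.lift F f a = UniversalEnvelopingAlgebra.lift F f b := by
  obtain ⟨rfl, x, rfl⟩ := hab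
  rw [← aeval_algHom_apply, ← central_eq_lift, h, map_zero]

/-- The representation of the reduced enveloping algebra extending a representation of `L`. -/
noncomputable def reducedLift {c : L →ₗ[F] AlgebraicClosure F}
    (h : ∀ x, aeval (P.central f x) (minpoly F (c x ^ p)) = 0) :
    RingQuot (uRel P c) →ₐ[F] A :=
  RingQuot.liftAlgHom F ⟨UniversalEnvelopingAlgebra.lift F f,
    fun _ _ hab => P.lift_eq_zero_of_uRel f h hab⟩

/-- The canonical map from `L` to its reduced enveloping algebra. -/
noncomputable def reducedι (c : L →ₗ[F] AlgebraicClosure F) : L →ₗ⁅F⁆ RingQuot (uRel P c) :=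
  (RingQuot.mkAlgHom F (uRel P c) :
    UniversalEnvelopingAlgebra F L →ₗ⁅F⁆ RingQuot (uRel P c)).comp
    (UniversalEnvelopingAlgebra.ι F)

theorem reducedLift_reducedι {c : L →ₗ[F] AlgebraicClosure F}
    (h : ∀ x, aeval (P.central f x) (minpoly F (c x ^ p)) = 0) (x : L) :
    P.reducedLift f h (P.reducedι c x) = f x := by
  have := RingQuot.liftAlgHom_mkAlgHom_apply F (UniversalEnvelopingAlgebra.lift F f)
    (fun _ _ hab => P.lift_eq_zero_of_uRel f h hab) (UniversalEnvelopingAlgebra.ι F x)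
  rw [UniversalEnvelopingAlgebra.lift_ι_apply] at this
  exact this

variable (c : L →ₗ[F] AlgebraicClosure F)

theorem aeval_central_reducedι (x : L) :
    aeval (P.central (P.reducedι c) x) (minpoly F (c x ^ p)) = 0 := by
  have h : P.central (P.reducedι c) x = RingQuot.mkAlgHom F (uRel P c)
      (UniversalEnvelopingAlgebra.ι F x ^ p - UniversalEnvelopingAlgebra.ι F (P.pOp x)) :=
    P.central_comp (UniversalEnvelopingAlgebra.ι F) (RingQuot.mkAlgHom F (uRel P c)) x
  rw [h, aeval_algHom_apply, RingQuot.mkAlgHom_rel F (show uRel P c _ 0 from ⟨rfl, x, rfl⟩),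
    map_zero]

theorem adjoin_range_ι :
    Algebra.adjoin F (Set.range (UniversalEnvelopingAlgebra.ι F : L → _)) = ⊤ := by
  set S := Algebra.adjoin F (Set.range (UniversalEnvelopingAlgebra.ι F : L → _)) with hS
  have hmem : ∀ x : L, UniversalEnvelopingAlgebra.ι F x ∈ S := fun x =>
    Algebra.subset_adjoin ⟨x, rfl⟩
  let g : L →ₗ⁅F⁆ S :=
    { toFun := fun x => ⟨UniversalEnvelopingAlgebra.ι F x, hmem x⟩
      map_add' := fun x y => Subtype.ext (map_add _ x y)
      map_smul' := fun t x => Subtype.ext (map_smul _ t x)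
      map_lie' := fun {x y} => Subtype.ext (LieHom.map_lie _ x y) }
  have h : S.val.comp (UniversalEnvelopingAlgebra.lift F g) = AlgHom.id F _ := by
    refine UniversalEnvelopingAlgebra.hom_ext F (LieHom.ext fun x => ?_)
    exact congrArg Subtype.val (UniversalEnvelopingAlgebra.lift_ι_apply F g x)
  refine eq_top_iff.mpr fun a _ => ?_
  rw [← AlgHom.id_apply (R := F) a, ← h]
  exact (UniversalEnvelopingAlgebra.lift F g a).2

theorem adjoin_range_reducedι : Algebra.adjoin F (Set.range (P.reducedι c)) = ⊤ := by
  have h : Set.range (P.reducedι c) = RingQuot.mkAlgHom F (uRel P c) ''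
      Set.range (UniversalEnvelopingAlgebra.ι F : L → _) := by
    rw [← Set.range_comp]; rfl
  rw [h, ← AlgHom.map_adjoin, adjoin_range_ι, Algebra.map_top, AlgHom.range_eq_top]
  exact RingQuot.mkAlgHom_surjective F _

theorem finite_ringQuot_uRel [Fact p.Prime] [FiniteDimensional F L] :
    FiniteDimensional F (RingQuot (uRel P c)) := by
  let e := Module.finBasis F L
  let f : Option (Fin (Module.finrank F L)) → RingQuot (uRel P c) :=
    fun i => i.elim 1 fun i => P.reducedι c (e i)
  have hone : (1 : RingQuot (uRel P c)) ∈ Submodule.span F (Set.range f) :=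
    Submodule.subset_span ⟨none, rfl⟩
  have hmem : ∀ x, P.reducedι c x ∈ Submodule.span F (Set.range f) := by
    intro x
    rw [← e.sum_repr x, map_sum]
    refine sum_mem fun i _ => ?_
    rw [map_smul]
    exact Submodule.smul_mem _ _ (Submodule.subset_span ⟨some i, rfl⟩)
  have hS : 1 ≤ Submodule.span F (Set.range f) := Submodule.one_le.mpr hone
  have hq : ∀ i, ∃ q, f i ^ (q + 1) ∈ Submodule.span F (Set.range f) ^ q := by
    rintro (_ | i)
    · refine ⟨0, ?_⟩
      rw [pow_zero, Submodule.mem_one]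
      exact ⟨1, by simp [f]⟩
    · have hint : IsIntegral F (c (e i) ^ p) := Algebra.IsIntegral.isIntegral _
      exact pow_mem_pow_of_aeval_eq_zero hS (Fact.out : p.Prime).two_le (hmem (e i))
        (hmem (P.pOp (e i))) (minpoly.monic hint) (minpoly.natDegree_pos hint)
        (P.aeval_central_reducedι c (e i))
  choose q hq using hq
  refine finite_of_pow_mem_pow hS ?_ q hq ?_
  · rintro (_ | i) (_ | j)
    · simp [f]
    · simp [f]
    · simp [f]
    · have := hmem ⁅e i, e j⁆
      rwa [LieHom.map_lie, LieRing.of_associative_ring_bracket] at this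
  · refine eq_top_iff.mpr ?_
    rw [← P.adjoin_range_reducedι c]
    refine Algebra.adjoin_le ?_
    rintro _ ⟨x, rfl⟩
    exact Algebra.span_le_adjoin F _ (hmem x)

theorem nontrivial_ringQuot_uRel [Fact p.Prime] [CharP F p] : Nontrivial (RingQuot (uRel P c)) := by
  obtain ⟨A, _, _, _, _, _, f, hf⟩ := P.exists_lieHom_central_eq (Module.Free.chooseBasis F L) c
  refine (P.reducedLift f (c := c) fun x => ?_).toRingHom.domain_nontrivial
  rw [hf, aeval_algebraMap_apply, minpoly.aeval, map_zero]

section Modules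

variable {V : Type} [AddCommGroup V] [Module F V] [LieRingModule L V] [LieModule F L V]

theorem finite_of_isIrreducible [Fact p.Prime] [FiniteDimensional F L]
    [LieModule.IsIrreducible F L V] (hV : IsReducedModule P c V) : FiniteDimensional F V := by
  have := P.finite_ringQuot_uRel c
  let ψ := P.reducedLift (LieModule.toEnd F L V) (c := c) hV
  have hψ : ∀ x v, ψ (P.reducedι c x) v = ⁅x, v⁆ := fun x v =>
    LinearMap.congr_fun (P.reducedLift_reducedι (LieModule.toEnd F L V) hV x) v
  have : Nontrivial V := (LieSubmodule.nontrivial_iff F L V).mp inferInstance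
  obtain ⟨v, hv⟩ := exists_ne (0 : V)
  let φ : RingQuot (uRel P c) →ₗ[F] V := (LinearMap.applyₗ v).comp ψ.toLinearMap
  have hφ : ∀ r, φ r = ψ r v := fun _ => rfl
  let N : LieSubmodule F L V :=
    { LinearMap.range φ with
      lie_mem := by
        rintro x _ ⟨r, rfl⟩
        exact ⟨P.reducedι c x * r, by rw [hφ, map_mul, Module.End.mul_apply, hψ, hφ]⟩ }
  have hvN : v ∈ N := ⟨1, by rw [hφ, map_one, Module.End.one_apply]⟩
  have hN : N = ⊤ := (eq_bot_or_eq_top N).resolve_left fun h => hv (by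
    rw [h] at hvN; exact (LieSubmodule.mem_bot v).mp hvN)
  refine Module.Finite.of_surjective φ fun w => ?_
  have hw : w ∈ N := hN ▸ LieSubmodule.mem_top w
  exact hw

theorem hasCluster_of_isReducedModule [Nontrivial V] {C : Set (L →ₗ[F] AlgebraicClosure F)}
    (hC : IsSimpleCluster C) {c : L →ₗ[F] AlgebraicClosure F} (hc : c ∈ C)
    (hV : IsReducedModule P c V) : HasCluster P V C := by
  intro x z
  have hint : IsIntegral F (c x ^ p) := Algebra.IsIntegral.isIntegral _
  rw [← minpoly.eq_of_irreducible_of_monic (minpoly.irreducible hint) (hV x) (minpoly.monic hint)]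
  constructor
  · intro h
    obtain ⟨σ, hσ⟩ := minpoly.exists_algEquiv_of_root' hint.isAlgebraic h
    exact ⟨_, hC.2.1 c hc σ, by rw [← hσ, map_pow]; rfl⟩
  · rintro ⟨c', hc', rfl⟩
    obtain ⟨σ, rfl⟩ := hC.2.2 c hc c' hc'
    have : (σ.toLinearMap ∘ₗ c) x ^ p = σ (c x ^ p) := by rw [map_pow]; rfl
    rw [this, ← AlgEquiv.coe_toAlgHom, aeval_algHom_apply, minpoly.aeval, map_zero]

end Modules

theorem exists_isIrreducible_isReducedModule [Fact p.Prime] [CharP F p] :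
    ∃ (V : Type) (_ : AddCommGroup V) (_ : Module F V) (_ : LieRingModule L V)
      (_ : LieModule F L V), LieModule.IsIrreducible F L V ∧ IsReducedModule P c V := by
  have := P.nontrivial_ringQuot_uRel c
  obtain ⟨I, hI⟩ := Ideal.exists_maximal (RingQuot (uRel P c))
  have hsimple : IsSimpleModule (RingQuot (uRel P c)) (RingQuot (uRel P c) ⧸ I) :=
    isSimpleModule_iff_isCoatom.mpr hI.out
  let V := RingQuot (uRel P c) ⧸ I
  let j := P.reducedι c
  let _ : LieRingModule L V :=
    { bracket := fun x v => j x • v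
      add_lie := fun x y v => by rw [map_add, add_smul]
      lie_add := fun x v w => smul_add _ _ _
      leibniz_lie := fun x y v => by
        rw [LieHom.map_lie, LieRing.of_associative_ring_bracket, sub_smul, mul_smul, mul_smul,
          sub_add_cancel] }
  have hlie : ∀ x (v : V), ⁅x, v⁆ = j x • v := fun _ _ => rfl
  let _ : LieModule F L V :=
    { smul_lie := fun t x v => by rw [hlie, hlie, map_smul, smul_assoc]
      lie_smul := fun t x v => by rw [hlie, hlie, smul_comm] }
  have htoEnd : ∀ x, LieModule.toEnd F L V x = Algebra.lsmul F F V (j x) := fun x =>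
    LinearMap.ext fun v => hlie x v
  have : Nontrivial V := IsSimpleModule.nontrivial (RingQuot (uRel P c)) V
  refine ⟨V, inferInstance, inferInstance, inferInstance, inferInstance,
    LieModule.IsIrreducible.mk fun N hN => ?_, fun x => ?_⟩
  · have hsmul : ∀ (r : RingQuot (uRel P c)), ∀ v ∈ N, r • v ∈ N := by
      intro r
      have hr : r ∈ Algebra.adjoin F (Set.range j) := by
        rw [P.adjoin_range_reducedι c]; trivial
      induction hr using Algebra.adjoin_induction with
      | mem r hr => obtain ⟨x, rfl⟩ := hr; exact fun v hv => N.lie_mem hv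
      | algebraMap t => intro v hv; rw [algebraMap_smul]; exact N.smul_mem t hv
      | add r s _ _ hr hs => intro v hv; rw [add_smul]; exact N.add_mem (hr v hv) (hs v hv)
      | mul r s _ _ hr hs => intro v hv; rw [mul_smul]; exact hr _ (hs v hv)
    let N' : Submodule (RingQuot (uRel P c)) V :=
      { N.toAddSubgroup with smul_mem' := fun r v hv => hsmul r v hv }
    obtain ⟨v, hv, hv0⟩ := N.toSubmodule.ne_bot_iff.mp fun h => hN (by simpa using h)
    have hN' : N' = ⊤ := (eq_bot_or_eq_top N').resolve_left fun h => hv0 (by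
      have hv' : v ∈ N' := hv
      rwa [h, Submodule.mem_bot] at hv')
    refine eq_top_iff.mpr fun w _ => ?_
    have hw : w ∈ N' := hN' ▸ Submodule.mem_top
    exact hw
  · have h : centralOp P V x = Algebra.lsmul F F V (P.central j x) := by
      rw [centralOp, central, htoEnd, htoEnd, map_sub, map_pow]
    rw [h, aeval_algHom_apply, P.aeval_central_reducedι c, map_zero]

end POperation

/-- Let `L` be a finite-dimensional restricted Lie algebra over a field
of characteristic `p > 0` and `C` a simple character cluster.  Then the `C`-reduced
enveloping algebra `u(L, C)` (the quotient of `U(L)` by the relations `uRel`) is a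
finite-dimensional `F`-algebra; every composition factor of `u(L, C)` as an `L`-module —
equivalently, every irreducible `L`-module on which the relations of `u(L, C)` act as
zero — is a finite-dimensional irreducible `L`-module with cluster `C`; in particular
there exists a finite-dimensional irreducible `L`-module with cluster `C`. -/
theorem reduced_enveloping_algebra_gives_irreducible_with_cluster
    [Fact p.Prime] [CharP F p] [FiniteDimensional F L]
    (P : POperation F L p) (C : Set (L →ₗ[F] AlgebraicClosure F))
    (hC : IsSimpleCluster C) (c : L →ₗ[F] AlgebraicClosure F) (hc : c ∈ C) :
    FiniteDimensional F (RingQuot (uRel P c)) ∧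
    (∀ (V : Type) [AddCommGroup V] [Module F V] [LieRingModule L V] [LieModule F L V],
      LieModule.IsIrreducible F L V → IsReducedModule P c V →
        FiniteDimensional F V ∧ HasCluster P V C) ∧
    Nonempty (IrredModWithCluster P C) := by
  have hpart : ∀ (V : Type) [AddCommGroup V] [Module F V] [LieRingModule L V] [LieModule F L V],
      LieModule.IsIrreducible F L V → IsReducedModule P c V →
        FiniteDimensional F V ∧ HasCluster P V C := by
    intro V _ _ _ _ hirr hV
    have : Nontrivial V := (LieSubmodule.nontrivial_iff F L V).mp inferInstance
    exact ⟨P.finite_of_isIrreducible c hV, P.hasCluster_of_isReducedModule hC hc hV⟩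
  obtain ⟨V, _, _, _, _, hirr, hV⟩ := P.exists_isIrreducible_isReducedModule c
  exact ⟨P.finite_ringQuot_uRel c, hpart,
    ⟨⟨V, (hpart V hirr hV).1, hirr, (hpart V hirr hV).2⟩⟩⟩
end

section
/- Let $L$ be a finite-dimensional restricted Lie algebra over a field $F$ of characteristic $p > 0$ that is not algebraically closed, with $p$-operation vanishing on the abelian socle of $L$. Then there exists a finite-dimensional irreducible $L$-module $V_0$ on which every abelian minimal ideal of $L$ acts non-trivially. -/
/-- A bundled finite-dimensional irreducible module on which every abelian minimal ideal
acts non-trivially. -/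
structure IrredModAbelianFaithful (F L : Type) [Field F] [LieRing L] [LieAlgebra F L] where
  carrier : Type
  [isAddCommGroup : AddCommGroup carrier]
  [isModule : Module F carrier]
  [isLieRingModule : LieRingModule L carrier]
  [isLieModule : LieModule F L carrier]
  finDim : FiniteDimensional F carrier
  irred : LieModule.IsIrreducible F L carrier
  abelian_nontrivial : ∀ A : LieIdeal F L, IsAtom A →
    (∀ a ∈ A, ∀ b ∈ A, ⁅a, b⁆ = (0 : L)) →
    ¬ (∀ x ∈ A, ∀ v : carrier, ⁅x, v⁆ = 0)

attribute [instance] IrredModAbelianFaithful.isAddCommGroup IrredModAbelianFaithful.isModule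
  IrredModAbelianFaithful.isLieRingModule IrredModAbelianFaithful.isLieModule

section ArtinSchreier

open Polynomial Finset

variable {E : Type*} [Field E] {σ : RingAut E} {q : ℕ}

theorem RingAut.pow_succ_apply' (σ : RingAut E) (i : ℕ) (x : E) :
    (σ ^ (i + 1)) x = σ ((σ ^ i) x) := by
  rw [pow_succ', RingAut.mul_apply]

/-- Independence of characters for the powers of an automorphism of order `q`. -/
theorem RingAut.exists_sum_pow_ne_zero (hσ : orderOf σ = q) (hq : 0 < q) (c : ℕ → E)
    (hc : c 0 ≠ 0) : ∃ x : E, ∑ i ∈ range q, c i * (σ ^ i) x ≠ 0 := by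
  by_contra! h
  have hli := linearIndependent_monoidHom E E
  have hinj : Function.Injective
      (fun i : Fin q ↦ (((σ ^ (i : ℕ) : RingAut E) : E →+* E) : E →* E)) := by
    intro i j hij
    have h2 : σ ^ (i : ℕ) = σ ^ (j : ℕ) := by
      ext x
      exact DFunLike.congr_fun hij x
    exact Fin.ext (pow_injOn_Iio_orderOf (by simp [hσ]) (by simp [hσ]) h2)
  have h3 := Fintype.linearIndependent_iff.mp (hli.comp _ hinj) (fun i ↦ c i) ?_ ⟨0, hq⟩
  · exact hc h3
  · ext x
    have := h x
    rw [Finset.sum_range] at this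
    simpa [Finset.sum_apply] using this

theorem RingAut.map_sum_pow (hσ : σ ^ q = 1) (x : E) :
    σ (∑ i ∈ range q, (σ ^ i) x) = ∑ i ∈ range q, (σ ^ i) x := by
  rw [map_sum]
  simp_rw [← RingAut.pow_succ_apply']
  have h1 := Finset.sum_range_succ (fun i ↦ (σ ^ i) x) q
  rw [Finset.sum_range_succ', hσ, pow_zero] at h1
  exact add_right_cancel h1

theorem RingAut.map_prod_pow (hσ : σ ^ q = 1) (x : E) :
    σ (∏ i ∈ range q, (σ ^ i) x) = ∏ i ∈ range q, (σ ^ i) x := by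
  rcases eq_or_ne x 0 with rfl | hx
  · rcases Nat.eq_zero_or_pos q with rfl | hq
    · simp
    · have h0 : ∏ i ∈ range q, (σ ^ i) (0 : E) = 0 :=
        Finset.prod_eq_zero (i := 0) (by simpa using hq) (by simp)
      rw [h0, map_zero]
  rw [map_prod]
  simp_rw [← RingAut.pow_succ_apply']
  have h1 := Finset.prod_range_succ (fun i ↦ (σ ^ i) x) q
  rw [Finset.prod_range_succ', hσ, pow_zero] at h1
  exact mul_right_cancel₀ hx h1

theorem RingAut.pow_apply_eq_self {x : E} (hx : σ x = x) (i : ℕ) : (σ ^ i) x = x := by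
  induction i with
  | zero => simp
  | succ i ih => rw [RingAut.pow_succ_apply', ih, hx]

theorem RingAut.map_of_mem_prime_field {p : ℕ} [Fact p.Prime] [CharP E p] (u : E)
    (hu : u ^ p = u) : σ u = u := by
  have h := (Subfield.mem_bot_iff_pow_eq_self E p).mpr hu
  have : (⊥ : Subfield E) ≤ (σ : E →+* E).eqLocusField (RingHom.id E) := bot_le
  exact this h

/-- A field of characteristic `p` with an automorphism of order `p` is not algebraically
closed. -/
theorem RingAut.orderOf_ne_char [IsAlgClosed E] (p : ℕ) [hp : Fact p.Prime] [CharP E p] :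
    orderOf σ ≠ p := by
  intro hσ
  have hσ' : σ ^ p = 1 := hσ ▸ pow_orderOf_eq_one σ
  obtain ⟨x, hx⟩ := RingAut.exists_sum_pow_ne_zero hσ hp.out.pos (fun _ ↦ 1) one_ne_zero
  simp only [one_mul] at hx
  set t := ∑ i ∈ range p, (σ ^ i) x with ht
  have htσ : σ t = t := RingAut.map_sum_pow hσ' x
  have hmul : ∀ {a : E}, σ a = a → ∀ y, ∑ i ∈ range p, (σ ^ i) (a * y) =
      a * ∑ i ∈ range p, (σ ^ i) y := by
    intro a ha y
    rw [Finset.mul_sum]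
    exact Finset.sum_congr rfl fun i _ ↦ by rw [map_mul, RingAut.pow_apply_eq_self ha]
  set y := t⁻¹ * x with hy
  have hTy : ∑ i ∈ range p, (σ ^ i) y = 1 := by
    rw [hy, hmul (by rw [map_inv₀, htσ]), ← ht, inv_mul_cancel₀ hx]
  set α := -∑ i ∈ range p, (i : E) * (σ ^ i) y with hα
  have hσα : σ α = α + 1 := by
    have h1 := Finset.sum_range_succ (fun i ↦ (i : E) * (σ ^ i) y) p
    rw [Finset.sum_range_succ'] at h1
    simp only [CharP.cast_eq_zero, zero_mul, add_zero, Nat.cast_zero] at h1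
    have h2 : ∑ i ∈ range p, (σ ^ (i + 1)) y = 1 := by
      simp_rw [RingAut.pow_succ_apply']
      rw [← map_sum, hTy, map_one]
    simp only [Nat.cast_add, Nat.cast_one, add_mul, one_mul, Finset.sum_add_distrib, h2] at h1
    rw [hα, map_neg, map_sum]
    simp only [map_mul, map_natCast, ← RingAut.pow_succ_apply']
    rw [← h1]
    ring
  set a := α ^ p - α with ha
  have hσa : σ a = a := by
    rw [ha, map_sub, map_pow, hσα, add_pow_char]
    ring
  obtain ⟨z, hz⟩ : ∃ z : E, z ^ p - z = a * y := by
    have hdeg : (X ^ p - X - C (a * y) : E[X]).degree = p := by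
      rw [sub_sub]
      have : (X + C (a * y) : E[X]).degree < (X ^ p : E[X]).degree := by
        rw [degree_X_add_C, degree_X_pow]
        exact_mod_cast hp.out.one_lt
      rw [degree_sub_eq_left_of_degree_lt this, degree_X_pow]
    obtain ⟨z, hz⟩ := IsAlgClosed.exists_root (X ^ p - X - C (a * y) : E[X]) (by
      rw [hdeg]; exact_mod_cast hp.out.pos.ne')
    refine ⟨z, ?_⟩
    simpa [IsRoot, sub_eq_zero] using hz
  set c := ∑ i ∈ range p, (σ ^ i) z with hc
  have hσc : σ c = c := RingAut.map_sum_pow hσ' z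
  have hca : c ^ p - c = a := by
    have : c ^ p = ∑ i ∈ range p, (σ ^ i) (z ^ p) := by
      rw [hc, sum_pow_char]
      simp only [map_pow]
    rw [this, hc, ← Finset.sum_sub_distrib]
    simp_rw [← map_sub, hz]
    rw [hmul hσa, hTy, mul_one]
  have hfix : σ (α - c) = α - c := by
    apply RingAut.map_of_mem_prime_field (p := p)
    rw [sub_pow_char]
    linear_combination ha - hca
  rw [map_sub, hσα, hσc] at hfix
  exact one_ne_zero (α := E) (by linear_combination hfix)

theorem RingAut.map_primitiveRoot_of_prime (hσ : σ ^ q = 1) (hq : q.Prime) {ζ : E}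
    (hζ : IsPrimitiveRoot ζ q) : σ ζ = ζ := by
  have : NeZero q := ⟨hq.ne_zero⟩
  obtain ⟨j, hj, hj'⟩ := hζ.eq_pow_of_pow_eq_one (ξ := σ ζ) (by
    rw [← map_pow, hζ.pow_eq_one, map_one])
  have hpow : ∀ i, (σ ^ i) ζ = ζ ^ (j ^ i) := by
    intro i
    induction i with
    | zero => simp
    | succ i ih => rw [RingAut.pow_succ_apply', ih, map_pow, ← hj', ← pow_mul, pow_succ']
  have h1 : ζ ^ (j ^ q) = ζ ^ 1 := by rw [← hpow, hσ, pow_one, RingAut.one_apply]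
  have : Fact q.Prime := ⟨hq⟩
  have hmod : j ^ q % q = j % q := by
    have h2 : ((j ^ q : ℕ) : ZMod q) = (j : ℕ) := by rw [Nat.cast_pow, ZMod.pow_card]
    exact (ZMod.natCast_eq_natCast_iff _ _ _).mp h2
  rw [← pow_mod_orderOf, ← hζ.eq_orderOf, hmod, hζ.eq_orderOf, pow_mod_orderOf, pow_one] at h1
  rw [← hj', h1]

/-- An automorphism of an algebraically closed field of positive characteristic does not have
prime order. -/
theorem RingAut.orderOf_ne_prime [IsAlgClosed E] (p : ℕ) [hp : Fact p.Prime] [CharP E p]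
    (hq : q.Prime) : orderOf σ ≠ q := by
  intro hσ
  have hqp : q ≠ p := by
    rintro rfl
    exact RingAut.orderOf_ne_char q hσ
  have hσ' : σ ^ q = 1 := hσ ▸ pow_orderOf_eq_one σ
  have : Fact q.Prime := ⟨hq⟩
  have : NeZero (q : E) := ⟨fun h ↦ hqp
    ((Nat.prime_dvd_prime_iff_eq hp.out hq).mp ((CharP.cast_eq_zero_iff E p q).mp h)).symm⟩
  obtain ⟨ζ, hζ⟩ := HasEnoughRootsOfUnity.exists_primitiveRoot E q
  have hζ0 : ζ ≠ 0 := hζ.ne_zero hq.ne_zero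
  have hσζ := RingAut.map_primitiveRoot_of_prime hσ' hq hζ
  obtain ⟨x, hx⟩ := RingAut.exists_sum_pow_ne_zero hσ hq.pos (fun i ↦ ζ ^ i) (by simp)
  set y := ∑ i ∈ range q, ζ ^ i * (σ ^ i) x with hy
  have hσy : ζ * σ y = y := by
    have h1 := Finset.sum_range_succ (fun i ↦ ζ ^ i * (σ ^ i) x) q
    rw [Finset.sum_range_succ', hσ', pow_zero, pow_zero, hζ.pow_eq_one] at h1
    rw [hy, map_sum, Finset.mul_sum, ← add_right_cancel h1]
    refine Finset.sum_congr rfl fun i _ ↦ ?_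
    rw [map_mul, map_pow, hσζ, ← RingAut.pow_succ_apply', pow_succ']
    ring
  have hpow : ∀ i, ζ ^ i * (σ ^ i) y = y := by
    intro i
    induction i with
    | zero => simp
    | succ i ih =>
      nth_rewrite 2 [← hσy]
      nth_rewrite 2 [← ih]
      rw [map_mul, map_pow, hσζ, RingAut.pow_succ_apply', pow_succ']
      ring
  have hNy : ζ ^ (∑ i ∈ range q, i) * ∏ i ∈ range q, (σ ^ i) y = y ^ q := by
    rw [← Finset.prod_pow_eq_pow_sum, ← Finset.prod_mul_distrib,
      Finset.prod_congr rfl fun i _ ↦ hpow i, Finset.prod_const, Finset.card_range]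
  obtain ⟨β, hβ⟩ := IsAlgClosed.exists_pow_nat_eq y hq.pos
  set c := ∏ i ∈ range q, (σ ^ i) β with hc
  have hσc : σ c = c := RingAut.map_prod_pow hσ' β
  have hcy : ∏ i ∈ range q, (σ ^ i) y = c ^ q := by
    simp_rw [hc, ← hβ, map_pow, Finset.prod_pow]
  have hc0 : c ≠ 0 := by
    rintro h
    rw [hcy, h, zero_pow hq.ne_zero, mul_zero] at hNy
    exact hx (pow_eq_zero_iff hq.ne_zero |>.mp hNy.symm)
  have hζ1 : ζ ≠ 1 := hζ.ne_one hq.one_lt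
  have hnotfix : σ y ≠ y := by
    intro h
    rw [h] at hσy
    exact hζ1 (mul_right_cancel₀ hx (by rw [hσy, one_mul]))
  rcases hq.eq_two_or_odd' with rfl | hodd
  · have hζm : ζ = -1 := hζ.eq_neg_one_of_two_right
    simp only [Finset.sum_range_succ, Finset.sum_range_zero, hζm, hcy] at hNy
    set u := y / c with hu
    have hu2 : u ^ 2 = -1 := by
      rw [hu, div_pow, ← hNy]
      field_simp
      ring
    have hσu : σ u = -u := by
      rw [hu, map_div₀, hσc]
      rw [hζm] at hσy
      rw [← neg_div]
      congr 1
      linear_combination -hσy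
    have hu0 : u ≠ 0 := div_ne_zero hx hc0
    obtain ⟨a, b, hab⟩ := ZMod.sq_add_sq p (-1)
    set f := ZMod.castHom (dvd_refl p) E
    have hab' : (f a) ^ 2 + (f b) ^ 2 = -1 := by
      rw [← map_pow, ← map_pow, ← map_add, hab, map_neg, map_one]
    have hf : ∀ a, σ (f a) = f a := fun a ↦
      RingAut.map_of_mem_prime_field (p := p) _ (by rw [← map_pow, ZMod.pow_card])
    obtain ⟨w, hw⟩ := IsAlgClosed.exists_pow_nat_eq (f a + f b * u) (n := 2) (by norm_num)
    have hσw : (σ w) ^ 2 = f a - f b * u := by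
      rw [← map_pow, hw, map_add, map_mul, hf, hf, hσu]
      ring
    have hfix : σ (w * σ w) = w * σ w := by
      have := RingAut.map_prod_pow hσ' w
      simpa [Finset.prod_range_succ] using this
    have hsq : (w * σ w) ^ 2 = u ^ 2 := by
      rw [mul_pow, hw, hσw, hu2]
      linear_combination hab' - (f b) ^ 2 * hu2
    have h2 : (2 : E) ≠ 0 := by
      have := NeZero.ne ((2 : ℕ) : E)
      simpa using this
    have : σ u = u := by
      rcases sq_eq_sq_iff_eq_or_eq_neg.mp hsq with h | h
      · rw [← h, hfix]
      · rw [show u = -(w * σ w) by rw [h, neg_neg], map_neg, hfix]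
    rw [hσu] at this
    exact hu0 ((mul_eq_zero.mp (by linear_combination -this : (2 : E) * u = 0)).resolve_left h2)
  · have hs : ζ ^ (∑ i ∈ range q, i) = 1 := by
      rw [hζ.pow_eq_one_iff_dvd, Finset.sum_range_id]
      obtain ⟨m, rfl⟩ := hodd
      exact ⟨m, by rw [Nat.add_sub_cancel, Nat.mul_div_assoc _ (dvd_mul_right 2 m)]; simp⟩
    rw [hs, one_mul, hcy] at hNy
    have : NeZero q := ⟨hq.ne_zero⟩
    obtain ⟨k, -, hk⟩ := hζ.eq_pow_of_pow_eq_one (ξ := y / c) (by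
      rw [div_pow, ← hNy, div_self (pow_ne_zero _ hc0)])
    apply hnotfix
    have : y = ζ ^ k * c := by rw [hk, div_mul_cancel₀ _ hc0]
    rw [this, map_mul, map_pow, hσζ, hσc]

/-- A field over which an algebraically closed field is finite is perfect. -/
theorem PerfectRing.of_finiteDimensional_isAlgClosed {F : Type*} [Field F] [Algebra F E]
    [FiniteDimensional F E] [IsAlgClosed E] (p : ℕ) [hp : Fact p.Prime] [CharP F p] :
    PerfectRing F p := by
  apply PerfectRing.ofSurjective
  intro a
  rw [← Set.mem_range]
  rcases eq_or_ne a 0 with rfl | ha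
  · exact ⟨0, map_zero _⟩
  obtain ⟨r, m, hm, hd⟩ := Nat.exists_eq_pow_mul_and_not_dvd
    (Module.finrank_pos (R := F) (M := E)).ne' p hp.out.ne_one
  obtain ⟨b, hb⟩ := IsAlgClosed.exists_pow_nat_eq (algebraMap F E a)
    (pow_pos hp.out.pos (r + 1))
  have hN := congrArg (Algebra.norm F) hb
  rw [map_pow, Algebra.norm_algebraMap, hd] at hN
  set n := Algebra.norm F b
  have h1 : n ^ p = a ^ m := by
    apply iterateFrobenius_inj F p r
    rw [iterateFrobenius_def, iterateFrobenius_def, ← pow_mul, ← pow_mul, ← pow_succ', hN,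
      mul_comm]
  have hcop : IsCoprime (m : ℤ) (p : ℤ) :=
    (Nat.isCoprime_iff_coprime.mpr ((Nat.Prime.coprime_iff_not_dvd hp.out).mpr hm)).symm
  obtain ⟨u, v, huv⟩ := hcop
  refine ⟨n ^ u * a ^ v, ?_⟩
  rw [frobenius_def, mul_pow, ← zpow_natCast, ← zpow_natCast, ← zpow_mul, ← zpow_mul,
    mul_comm u, zpow_mul, zpow_natCast, h1, ← zpow_natCast a m, ← zpow_mul, ← zpow_add₀ ha,
    mul_comm (m : ℤ), huv, zpow_one]

/-- The Artin–Schreier theorem in positive characteristic. -/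
theorem IsAlgClosed.of_finiteDimensional_of_charP.{u} {F E : Type u} [Field F] [Field E] [Algebra F E]
    [FiniteDimensional F E] [IsAlgClosed E] (p : ℕ) [hp : Fact p.Prime] [CharP F p] :
    IsAlgClosed F := by
  have := PerfectRing.of_finiteDimensional_isAlgClosed (F := F) (E := E) p
  have := PerfectRing.toPerfectField F p
  have : CharP E p := charP_of_injective_algebraMap (algebraMap F E).injective p
  have : IsAlgClosure F E := ⟨inferInstance, inferInstance⟩
  have : IsGalois F E := {}
  by_cases h1 : Module.finrank F E = 1
  · have hb : Function.Bijective (algebraMap F E) :=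
      bijective_algebraMap_of_linearEquiv
        (LinearEquiv.ofFinrankEq F E (by rw [h1, Module.finrank_self]))
    exact IsAlgClosed.of_ringEquiv E F (RingEquiv.ofBijective _ hb).symm
  · exfalso
    rw [← IsGalois.card_aut_eq_finrank] at h1
    obtain ⟨q, hq, hdvd⟩ := Nat.exists_prime_and_dvd h1
    have : Fact q.Prime := ⟨hq⟩
    obtain ⟨τ, hτ⟩ := exists_prime_orderOf_dvd_card' q hdvd
    let φ : Gal(E/F) →* RingAut E :=
      { toFun := fun τ ↦ τ.toRingEquiv
        map_one' := rfl
        map_mul' := fun _ _ ↦ rfl }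
    have hφ : Function.Injective φ := fun a b h ↦ AlgEquiv.ext fun x ↦ DFunLike.congr_fun h x
    exact RingAut.orderOf_ne_prime (σ := φ τ) p hq (by rw [orderOf_injective φ hφ, hτ])

theorem exists_finiteDimensional_le_finrank {F : Type} [Field F] (hF : ¬ IsAlgClosed F) (p : ℕ)
    [Fact p.Prime] [CharP F p] (n : ℕ) :
    ∃ (K : Type) (_ : Field K) (_ : Algebra F K), FiniteDimensional F K ∧
      n ≤ Module.finrank F K := by
  have hinf : ¬ FiniteDimensional F (AlgebraicClosure F) := fun _ ↦
    hF (IsAlgClosed.of_finiteDimensional_of_charP (E := AlgebraicClosure F) p)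
  have hrank : (n : Cardinal) ≤ Module.rank F (AlgebraicClosure F) := by
    rw [FiniteDimensional, ← Module.rank_lt_aleph0_iff, not_lt] at hinf
    exact (Cardinal.natCast_le_aleph0).trans hinf
  obtain ⟨s, hs, hli⟩ := le_rank_iff_exists_linearIndependent_finset.mp hrank
  have hfd : FiniteDimensional F (IntermediateField.adjoin F (s : Set (AlgebraicClosure F))) :=
    IntermediateField.finiteDimensional_adjoin fun x _ ↦ Algebra.IsIntegral.isIntegral x
  refine ⟨IntermediateField.adjoin F (s : Set (AlgebraicClosure F)), inferInstance,
    inferInstance, hfd, ?_⟩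
  let g : s → IntermediateField.adjoin F (s : Set (AlgebraicClosure F)) := fun x ↦
    ⟨x, IntermediateField.subset_adjoin F _ x.2⟩
  have hg : LinearIndependent F g :=
    LinearIndependent.of_comp (IntermediateField.val _).toLinearMap hli
  simpa [hs] using hg.fintype_card_le_finrank

end ArtinSchreier

section BaseChangeDerivation

open TensorProduct LieAlgebra

variable {F L A B : Type*} [Field F] [LieRing L] [LieAlgebra F L]
  [CommRing A] [Algebra F A] [CommRing B] [Algebra F B]

/-- The action of a derivation of `A` on the coefficients of `A ⊗ L`. -/
noncomputable def Derivation.baseChangeCoeff (L : Type*) [LieRing L] [LieAlgebra F L]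
    (D : Derivation F A A) : A ⊗[F] L →ₗ[F] A ⊗[F] L :=
  (D : A →ₗ[F] A).rTensor L

@[simp]
theorem Derivation.baseChangeCoeff_tmul (D : Derivation F A A) (a : A) (x : L) :
    D.baseChangeCoeff L (a ⊗ₜ x) = D a ⊗ₜ x := rfl

theorem Derivation.baseChangeCoeff_smul (D : Derivation F A A) (a : A) (v : A ⊗[F] L) :
    D.baseChangeCoeff L (a • v) = D a • v + a • D.baseChangeCoeff L v := by
  induction v with
  | zero => simp
  | tmul c x =>
    simp only [TensorProduct.smul_tmul', Derivation.baseChangeCoeff_tmul, smul_eq_mul,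
      Derivation.leibniz, TensorProduct.add_tmul]
    rw [add_comm, mul_comm c]
  | add v w hv hw => simp only [smul_add, map_add, hv, hw]; abel

theorem Derivation.baseChangeCoeff_lie (D : Derivation F A A) (v w : A ⊗[F] L) :
    D.baseChangeCoeff L ⁅v, w⁆ = ⁅D.baseChangeCoeff L v, w⁆ + ⁅v, D.baseChangeCoeff L w⁆ := by
  induction v with
  | zero => simp
  | tmul c x =>
    induction w with
    | zero => simp
    | tmul d y =>
      simp only [ExtendScalars.bracket_tmul, Derivation.baseChangeCoeff_tmul,
        Derivation.leibniz, TensorProduct.add_tmul, smul_eq_mul]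
      rw [add_comm, mul_comm d]
    | add v w hv hw => simp only [lie_add, map_add, hv, hw]; abel
  | add v w hv hw => simp only [add_lie, map_add, hv, hw]; abel

variable {ι : Type*}

theorem repr_baseChangeCoeff (b : Module.Basis ι F L) (D : Derivation F A A)
    (v : A ⊗[F] L) (k : ι) :
    (b.baseChange A).repr (D.baseChangeCoeff L v) k = D ((b.baseChange A).repr v k) := by
  induction v with
  | zero => simp
  | tmul a x => simp
  | add v w hv hw => simp [hv, hw]

theorem repr_map_baseChange (b : Module.Basis ι F L) (f : A →ₐ[F] B) (v : A ⊗[F] L) (k : ι) :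
    (b.baseChange B).repr (ExtendScalars.map f (LieHom.id : L →ₗ⁅F⁆ L) v) k =
      f ((b.baseChange A).repr v k) := by
  induction v with
  | zero => simp
  | tmul a x =>
    rw [show ExtendScalars.map f (LieHom.id : L →ₗ⁅F⁆ L) (a ⊗ₜ x) = f a ⊗ₜ x from rfl]
    simp
  | add v w hv hw => simp [hv, hw]

variable [Fintype ι]

/-- The `A`-linear endomorphism of `A ⊗ L` with matrix `g` in the basis `b` of `L`. -/
noncomputable def matrixBaseChange (b : Module.Basis ι F L) (g : ι → ι → A) :
    A ⊗[F] L →ₗ[A] A ⊗[F] L :=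
  (b.baseChange A).constr A fun l ↦ ∑ k, g k l ⊗ₜ b k

theorem matrixBaseChange_tmul_basis (b : Module.Basis ι F L) (g : ι → ι → A) (a : A) (l : ι) :
    matrixBaseChange b g (a ⊗ₜ b l) = ∑ k, (a * g k l) ⊗ₜ b k := by
  have h : a ⊗ₜ[F] b l = a • (b.baseChange A) l := by
    rw [Module.Basis.baseChange_apply, TensorProduct.smul_tmul', smul_eq_mul, mul_one]
  rw [h, map_smul, matrixBaseChange, Module.Basis.constr_basis, Finset.smul_sum]
  simp only [TensorProduct.smul_tmul', smul_eq_mul]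

theorem tensor_induction_basis (b : Module.Basis ι F L) {P : A ⊗[F] L → Prop}
    (hb : ∀ a l, P (a ⊗ₜ b l)) (hadd : ∀ v w, P v → P w → P (v + w)) (h0 : P 0)
    (v : A ⊗[F] L) : P v := by
  induction v with
  | zero => exact h0
  | tmul a x =>
    rw [← b.sum_repr x, TensorProduct.tmul_sum]
    refine Finset.sum_induction _ P hadd h0 fun l _ ↦ ?_
    rw [← TensorProduct.smul_tmul]
    exact hb _ _
  | add v w hv hw => exact hadd v w hv hw

theorem baseChangeCoeff_matrixBaseChange_of_apply_eq_zero (b : Module.Basis ι F L)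
    (D : Derivation F A A) (g : ι → ι → A) (hg : ∀ k l, D (g k l) = 0) (v : A ⊗[F] L) :
    D.baseChangeCoeff L (matrixBaseChange b g v) =
      matrixBaseChange b g (D.baseChangeCoeff L v) := by
  induction v using tensor_induction_basis b with
  | hb a l => simp [matrixBaseChange_tmul_basis, hg, mul_comm]
  | hadd v w hv hw => simp only [map_add, hv, hw]
  | h0 => simp

theorem baseChangeCoeff_matrixBaseChange_of_apply_eq_ad (b : Module.Basis ι F L) (x : L)
    (D : Derivation F A A) (g : ι → ι → A)
    (hg : ∀ k l, D (g k l) = ∑ m, b.repr ⁅x, b m⁆ k • g m l) (v : A ⊗[F] L) :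
    D.baseChangeCoeff L (matrixBaseChange b g v) =
      ⁅(1 : A) ⊗ₜ[F] x, matrixBaseChange b g v⁆ +
        matrixBaseChange b g (D.baseChangeCoeff L v) := by
  induction v using tensor_induction_basis b with
  | hb a l =>
    simp only [matrixBaseChange_tmul_basis, map_sum, Derivation.baseChangeCoeff_tmul,
      Derivation.leibniz, hg, TensorProduct.add_tmul, Finset.sum_add_distrib, lie_sum,
      ExtendScalars.bracket_tmul, one_mul, smul_eq_mul]
    congr 1
    · have h1 : ∀ m, (a * g m l) ⊗ₜ[F] ⁅x, b m⁆ =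
          ∑ k, (a * g m l) ⊗ₜ[F] (b.repr ⁅x, b m⁆ k • b k) := fun m ↦ by
        rw [← TensorProduct.tmul_sum, b.sum_repr]
      simp_rw [h1, Finset.mul_sum, TensorProduct.sum_tmul]
      rw [Finset.sum_comm]
      refine Finset.sum_congr rfl fun m _ ↦ Finset.sum_congr rfl fun k _ ↦ ?_
      rw [← TensorProduct.smul_tmul, mul_smul_comm]
    · simp only [mul_comm]
  | hadd v w hv hw => simp only [map_add, lie_add, hv, hw]; abel
  | h0 => simp

theorem map_matrixBaseChange (b : Module.Basis ι F L) (f : A →ₐ[F] B) (g : ι → ι → A)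
    (v : A ⊗[F] L) :
    ExtendScalars.map f (LieHom.id : L →ₗ⁅F⁆ L) (matrixBaseChange b g v) =
      matrixBaseChange b (fun k l ↦ f (g k l)) (ExtendScalars.map f LieHom.id v) := by
  induction v using tensor_induction_basis b with
  | hb a l =>
    have h : ∀ (a : A) (x : L), ExtendScalars.map f (LieHom.id : L →ₗ⁅F⁆ L) (a ⊗ₜ x) =
      f a ⊗ₜ x := fun _ _ ↦ rfl
    simp [matrixBaseChange_tmul_basis, h]
  | hadd v w hv hw => simp only [map_add, hv, hw]
  | h0 => simp

theorem matrixBaseChange_one [DecidableEq ι] (b : Module.Basis ι F L) (v : A ⊗[F] L) :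
    matrixBaseChange b (fun k l ↦ if k = l then (1 : A) else 0) v = v := by
  induction v using tensor_induction_basis b with
  | hb a l => simp [matrixBaseChange_tmul_basis, TensorProduct.ite_tmul]
  | hadd v w hv hw => simp only [map_add, hv, hw]
  | h0 => simp

theorem repr_lie_one_tmul (b : Module.Basis ι F L) (x : L) (v : A ⊗[F] L) (k : ι) :
    (b.baseChange A).repr ⁅(1 : A) ⊗ₜ[F] x, v⁆ k =
      ∑ m, b.repr ⁅x, b m⁆ k • (b.baseChange A).repr v m := by
  induction v using tensor_induction_basis b with
  | hb a l =>
    classical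
    simp only [ExtendScalars.bracket_tmul, one_mul, Module.Basis.baseChange_repr_tmul,
      Module.Basis.repr_self]
    rw [Finset.sum_eq_single l]
    · simp
    · intro m _ hm
      simp [hm.symm]
    · simp
  | hadd v w hv hw => simp [hv, hw, Finset.sum_add_distrib]
  | h0 => simp

end BaseChangeDerivation

section FlatFrame

open TensorProduct LieAlgebra

variable {F L A : Type*} [Field F] [LieRing L] [LieAlgebra F L] [CommRing A] [Algebra F A]
  {n : ℕ}

/-- A basis of `A ⊗ L` satisfying the Maurer-Cartan equation with respect to commuting
derivations of `A` gives an action of `L` on `A` by derivations. -/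
theorem exists_lieHom_derivation_of_flat (D : Fin n → Derivation F A A)
    (hD : ∀ i j a, D i (D j a) = D j (D i a)) (θ : Module.Basis (Fin n) A (A ⊗[F] L))
    (hθ : ∀ i j, (D i).baseChangeCoeff L (θ j) - (D j).baseChangeCoeff L (θ i) = ⁅θ i, θ j⁆) :
    ∃ ρ : L →ₗ⁅F⁆ Derivation F A A, ∀ x a, ρ x a = -∑ i, θ.repr (1 ⊗ₜ x) i * D i a := by
  have hzero : ∀ i y, ∑ j, (D i (θ.repr (1 ⊗ₜ y) j) • θ j +
      θ.repr (1 ⊗ₜ y) j • (D i).baseChangeCoeff L (θ j)) = 0 := by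
    intro i y
    simp_rw [← Derivation.baseChangeCoeff_smul, ← map_sum, θ.sum_repr]
    simp
  have key : ∀ x y j, ∑ i, (θ.repr (1 ⊗ₜ x) i * D i (θ.repr (1 ⊗ₜ y) j) -
      θ.repr (1 ⊗ₜ y) i * D i (θ.repr (1 ⊗ₜ x) j)) = -θ.repr (1 ⊗ₜ ⁅x, y⁆) j := by
    intro x y
    have h1 : ∀ x y, ∑ j, (∑ i, θ.repr (1 ⊗ₜ x) i * D i (θ.repr (1 ⊗ₜ y) j)) • θ j =
        -∑ i, ∑ j, (θ.repr (1 ⊗ₜ x) i * θ.repr (1 ⊗ₜ y) j) •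
          (D i).baseChangeCoeff L (θ j) := by
      intro x y
      rw [← sub_eq_zero, sub_neg_eq_add]
      simp_rw [Finset.sum_smul]
      rw [Finset.sum_comm, ← Finset.sum_add_distrib]
      refine Finset.sum_eq_zero fun i _ ↦ ?_
      rw [← Finset.sum_add_distrib]
      simp_rw [mul_smul, ← smul_add]
      rw [← Finset.smul_sum, hzero, smul_zero]
    have h2 : ∑ j, (∑ i, (θ.repr (1 ⊗ₜ x) i * D i (θ.repr (1 ⊗ₜ y) j) -
        θ.repr (1 ⊗ₜ y) i * D i (θ.repr (1 ⊗ₜ x) j))) • θ j = -(1 : A) ⊗ₜ[F] ⁅x, y⁆ := by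
      simp_rw [Finset.sum_sub_distrib, sub_smul]
      rw [Finset.sum_sub_distrib, h1, h1]
      have h3 : (1 : A) ⊗ₜ[F] ⁅x, y⁆ = ∑ i, ∑ j, (θ.repr (1 ⊗ₜ x) i * θ.repr (1 ⊗ₜ y) j) •
          ⁅θ i, θ j⁆ := by
        have h4 : (1 : A) ⊗ₜ[F] ⁅x, y⁆ = ⁅(1 : A) ⊗ₜ[F] x, (1 : A) ⊗ₜ[F] y⁆ := by
          rw [ExtendScalars.bracket_tmul, one_mul]
        rw [h4]
        nth_rewrite 1 [← θ.sum_repr (1 ⊗ₜ x), ← θ.sum_repr (1 ⊗ₜ y)]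
        simp_rw [sum_lie, lie_sum, smul_lie, lie_smul, smul_smul]
      rw [h3]
      simp_rw [← hθ, smul_sub, Finset.sum_sub_distrib]
      rw [Finset.sum_comm (f := fun i j ↦ (θ.repr (1 ⊗ₜ y) i * θ.repr (1 ⊗ₜ x) j) •
          (D i).baseChangeCoeff L (θ j))]
      simp_rw [mul_comm (θ.repr (1 ⊗ₜ y) _)]
      abel
    intro j
    have h5 := congrArg (fun v ↦ θ.repr v j) h2
    simpa only [θ.repr_sum_self, map_neg, Finsupp.neg_apply] using h5
  let ρ : L →ₗ[F] Derivation F A A :=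
    { toFun := fun x ↦ -∑ i, θ.repr (1 ⊗ₜ x) i • D i
      map_add' := fun x y ↦ by
        simp only [TensorProduct.tmul_add, map_add, Finsupp.add_apply, add_smul,
          Finset.sum_add_distrib, neg_add]
      map_smul' := fun t x ↦ by
        have : ∀ i, θ.repr ((1 : A) ⊗ₜ[F] (t • x)) i = t • θ.repr (1 ⊗ₜ x) i := fun i ↦ by
          rw [TensorProduct.tmul_smul, ← algebraMap_smul A t (_ : A ⊗[F] L), map_smul,
            Finsupp.smul_apply, algebraMap_smul]
        simp only [this, smul_assoc, ← Finset.smul_sum, smul_neg, RingHom.id_apply] }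
  have hρ : ∀ x a, ρ x a = -∑ i, θ.repr (1 ⊗ₜ x) i * D i a := fun x a ↦ by
    change (-∑ i, θ.repr (1 ⊗ₜ x) i • D i : Derivation F A A) a = _
    have := congrFun (map_sum Derivation.coeFnAddMonoidHom
      (fun i ↦ θ.repr ((1 : A) ⊗ₜ[F] x) i • D i) Finset.univ) a
    rw [Finset.sum_apply] at this
    rw [Derivation.coe_neg, Pi.neg_apply]
    exact congrArg Neg.neg this
  refine ⟨{ ρ with map_lie' := fun {x y} ↦ ?_ }, hρ⟩
  ext a
  change ρ ⁅x, y⁆ a = ⁅ρ x, ρ y⁆ a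
  rw [Derivation.commutator_apply]
  have h : ∀ x y, ρ x (ρ y a) = ∑ i, ∑ j, θ.repr (1 ⊗ₜ x) i * θ.repr (1 ⊗ₜ y) j * D i (D j a) +
      ∑ j, (∑ i, θ.repr (1 ⊗ₜ x) i * D i (θ.repr (1 ⊗ₜ y) j)) * D j a := fun x y ↦ by
    simp only [hρ, map_neg, map_sum, Derivation.leibniz, smul_eq_mul, mul_neg,
      Finset.sum_neg_distrib, neg_neg, Finset.mul_sum, Finset.sum_mul, mul_add,
      Finset.sum_add_distrib]
    congr 1
    · simp only [mul_assoc]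
    · rw [Finset.sum_comm]
      refine Finset.sum_congr rfl fun _ _ ↦ Finset.sum_congr rfl fun _ _ ↦ ?_
      ring
  have h' : ∑ i, ∑ j, θ.repr (1 ⊗ₜ x) i * θ.repr (1 ⊗ₜ y) j * D i (D j a) =
      ∑ i, ∑ j, θ.repr (1 ⊗ₜ y) i * θ.repr (1 ⊗ₜ x) j * D i (D j a) := by
    rw [Finset.sum_comm]
    refine Finset.sum_congr rfl fun i _ ↦ Finset.sum_congr rfl fun j _ ↦ ?_
    rw [hD i j]
    ring
  rw [h, h, hρ, h', add_sub_add_left_eq_sub, ← Finset.sum_sub_distrib, ← Finset.sum_neg_distrib]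
  refine Finset.sum_congr rfl fun j _ ↦ ?_
  rw [← neg_mul, ← key, ← sub_mul, ← Finset.sum_sub_distrib]

end FlatFrame

section Frame

open TensorProduct LieAlgebra

variable {F L A K : Type*} [Field F] [LieRing L] [LieAlgebra F L] [CommRing A] [Algebra F A]
  [Field K] [Algebra F K] {n : ℕ}

/-- The ordered product `G 0 ∘ ⋯ ∘ G (m - 1)`. -/
noncomputable def orderedComp {V : Type*} [AddCommGroup V] [Module A V] (G : Fin n → V →ₗ[A] V) :
    ℕ → V →ₗ[A] V
  | 0 => LinearMap.id
  | m + 1 => orderedComp G m ∘ₗ (if h : m < n then G ⟨m, h⟩ else LinearMap.id)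

/-- A family of matrices over `A`, the `i`-th of which is a solution of the linear differential
equation defined by `ad (b i)`, gives rise to a flat frame of `A ⊗ L`. -/
theorem exists_flat_basis (b : Module.Basis (Fin n) F L) (D : Fin n → Derivation F A A)
    (g : Fin n → Fin n → Fin n → A)
    (hg : ∀ i k l, D i (g i k l) = ∑ m, b.repr ⁅b i, b m⁆ k • g i m l)
    (hg0 : ∀ i j, i ≠ j → ∀ k l, D i (g j k l) = 0)
    (hlie : ∀ i v w, matrixBaseChange b (g i) ⁅v, w⁆ =
      ⁅matrixBaseChange b (g i) v, matrixBaseChange b (g i) w⁆)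
    (ε : A →ₐ[F] K) (hε : ∀ i k l, ε (g i k l) = if k = l then 1 else 0)
    (hunit : ∀ u, ε u ≠ 0 → IsUnit u) :
    ∃ θ : Module.Basis (Fin n) A (A ⊗[F] L),
      (∀ i j, (D i).baseChangeCoeff L (θ j) - (D j).baseChangeCoeff L (θ i) = ⁅θ i, θ j⁆) ∧
      ∀ i, (∀ j < i, matrixBaseChange b (g j) (1 ⊗ₜ b i) = 1 ⊗ₜ b i) → θ i = 1 ⊗ₜ b i := by
  set T := orderedComp (fun i ↦ matrixBaseChange b (g i)) with hT
  have hT0 : ∀ v, T 0 v = v := fun v ↦ rfl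
  have hTs : ∀ m (h : m < n) v, T (m + 1) v = T m (matrixBaseChange b (g ⟨m, h⟩) v) := by
    intro m h v
    simp [hT, orderedComp, h]
  have hTs' : ∀ m, ¬ m < n → ∀ v, T (m + 1) v = T m v := by
    intro m h v
    simp [hT, orderedComp, h]
  have hTlie : ∀ m v w, T m ⁅v, w⁆ = ⁅T m v, T m w⁆ := by
    intro m
    induction m with
    | zero => exact fun v w ↦ rfl
    | succ m ih =>
      intro v w
      by_cases h : m < n
      · simp only [hTs m h, hlie, ih]
      · simp only [hTs' m h, ih]
  have hTε : ∀ m v, ExtendScalars.map ε (LieHom.id : L →ₗ⁅F⁆ L) (T m v) =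
      ExtendScalars.map ε LieHom.id v := by
    intro m
    induction m with
    | zero => exact fun v ↦ rfl
    | succ m ih =>
      intro v
      by_cases h : m < n
      · rw [hTs m h, ih, map_matrixBaseChange]
        simp only [hε]
        rw [matrixBaseChange_one]
      · rw [hTs' m h, ih]
  have hge : ∀ (m : ℕ) (i : Fin n), m ≤ i → ∀ v, (D i).baseChangeCoeff L (T m v) =
      T m ((D i).baseChangeCoeff L v) := by
    intro m
    induction m with
    | zero => exact fun i _ v ↦ rfl
    | succ m ih =>
      intro i hi v
      have h : m < n := by omega
      rw [hTs m h, hTs m h, ih i (by omega), baseChangeCoeff_matrixBaseChange_of_apply_eq_zero]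
      exact hg0 _ _ (fun h ↦ by simp [h] at hi)
  have hlt : ∀ (m : ℕ) (i : Fin n), i < m → ∀ v, (D i).baseChangeCoeff L (T m v) =
      ⁅T i (1 ⊗ₜ b i), T m v⁆ + T m ((D i).baseChangeCoeff L v) := by
    intro m
    induction m with
    | zero => exact fun i hi ↦ by omega
    | succ m ih =>
      intro i hi v
      by_cases h : m < n
      · rw [hTs m h, hTs m h]
        obtain hi | hi := Nat.lt_succ_iff_lt_or_eq.mp hi
        · rw [ih i hi, baseChangeCoeff_matrixBaseChange_of_apply_eq_zero]
          exact hg0 _ _ (fun h ↦ by simp [h] at hi)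
        · obtain rfl : i = ⟨m, h⟩ := Fin.ext hi
          rw [hge m _ le_rfl, baseChangeCoeff_matrixBaseChange_of_apply_eq_ad b (b ⟨m, h⟩) _ _
            (hg _), map_add, hTlie]
      · rw [hTs' m h, hTs' m h, ih i (by omega)]
  let θ : Fin n → A ⊗[F] L := fun i ↦ T i (1 ⊗ₜ b i)
  have hθlt : ∀ i j, i < j → (D i).baseChangeCoeff L (θ j) = ⁅θ i, θ j⁆ := by
    intro i j hij
    simp [θ, hlt j i hij]
  have hθge : ∀ i j, j ≤ i → (D i).baseChangeCoeff L (θ j) = 0 := by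
    intro i j hij
    simp [θ, hge j i hij]
  have hdet : IsUnit ((b.baseChange A).det θ) := by
    refine hunit _ ?_
    have h1 : ((b.baseChange A).toMatrix θ).map ε = 1 := by
      ext k i
      rw [Matrix.map_apply, Module.Basis.toMatrix_apply, ← repr_map_baseChange, hTε,
        repr_map_baseChange]
      simp [Matrix.one_apply, Finsupp.single_apply, eq_comm]
    rw [Module.Basis.det_apply, AlgHom.map_det, AlgHom.mapMatrix_apply, h1, Matrix.det_one]
    exact one_ne_zero
  obtain ⟨hli, hsp⟩ := ((b.baseChange A).is_basis_iff_det).mpr hdet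
  refine ⟨Module.Basis.mk hli hsp.ge, fun i j ↦ ?_, fun i hi ↦ ?_⟩
  · rw [Module.Basis.mk_apply, Module.Basis.mk_apply]
    rcases lt_trichotomy i j with h | rfl | h
    · rw [hθlt i j h, hθge j i h.le, sub_zero]
    · rw [sub_self, lie_self]
    · rw [hθlt j i h, hθge i j h.le, zero_sub, lie_skew]
  · rw [Module.Basis.mk_apply]
    have : ∀ m, m ≤ (i : ℕ) → T m (1 ⊗ₜ b i) = 1 ⊗ₜ b i := by
      intro m
      induction m with
      | zero => exact fun _ ↦ rfl
      | succ m ih =>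
        intro hm
        rw [hTs m (by omega), hi ⟨m, by omega⟩ (Fin.lt_def.mpr hm), ih (by omega)]
    exact this i le_rfl

end Frame

section DerivationAction

open TensorProduct LieAlgebra

variable {F L A K : Type*} [Field F] [LieRing L] [LieAlgebra F L] [CommRing A] [Algebra F A]
  [Field K] [Algebra F K] {n : ℕ}

theorem exists_lieHom_derivation (b : Module.Basis (Fin n) F L) (D : Fin n → Derivation F A A)
    (hD : ∀ i j a, D i (D j a) = D j (D i a)) (g : Fin n → Fin n → Fin n → A)
    (hg : ∀ i k l, D i (g i k l) = ∑ m, b.repr ⁅b i, b m⁆ k • g i m l)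
    (hg0 : ∀ i j, i ≠ j → ∀ k l, D i (g j k l) = 0)
    (hlie : ∀ i v w, matrixBaseChange b (g i) ⁅v, w⁆ =
      ⁅matrixBaseChange b (g i) v, matrixBaseChange b (g i) w⁆)
    (ε : A →ₐ[F] K) (hε : ∀ i k l, ε (g i k l) = if k = l then 1 else 0)
    (hunit : ∀ u, ε u ≠ 0 → IsUnit u) :
    ∃ ρ : L →ₗ⁅F⁆ Derivation F A A,
      (∀ c, (∀ i, D i c = 0) → ∀ x, ρ x c = 0) ∧
      ∀ i, (∀ j < i, matrixBaseChange b (g j) (1 ⊗ₜ b i) = 1 ⊗ₜ b i) →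
        ∀ a, ρ (b i) a = -D i a := by
  obtain ⟨θ, hθ, hθb⟩ := exists_flat_basis b D g hg hg0 hlie ε hε hunit
  obtain ⟨ρ, hρ⟩ := exists_lieHom_derivation_of_flat D hD θ hθ
  refine ⟨ρ, fun c hc x ↦ by simp [hρ, hc], fun i hi a ↦ ?_⟩
  rw [hρ, ← hθb i hi, θ.repr_self, Finset.sum_eq_single i]
  · simp
  · intro j _ hj
    simp [hj.symm]
  · simp

end DerivationAction

section FrobeniusQuotient

theorem Derivation.apply_pow_char_eq_zero {F B : Type*} [Field F] [CommRing B] [Algebra F B]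
    {p : ℕ} [CharP F p] (D : Derivation F B B) (u : B) : D (u ^ p) = 0 := by
  rw [Derivation.leibniz_pow, ← Nat.cast_smul_eq_nsmul F p, CharP.cast_eq_zero, zero_smul]

open TensorProduct LieAlgebra

variable {F L K B : Type} [Field F] [LieRing L] [LieAlgebra F L] [Field K] [Algebra F K]
  [CommRing B] [Algebra K B] [Algebra F B] [IsScalarTower F K B] {n p : ℕ}

/-- Imposing on an augmented `K`-algebra the relations `u ^ p = ε(u) ^ p`, together with the
vanishing of a set of tensors which is horizontal for the given derivations, produces a
finite-dimensional local `K`-algebra to which the derivations descend. -/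
theorem exists_finite_quotient [Fact p.Prime] [CharP F p] [Algebra.FiniteType K B]
    (b : Module.Basis (Fin n) F L)
    (D : Fin n → Derivation F B B) (ε : B →ₐ[K] K)
    (R : Set (B ⊗[F] L))
    (hε : ∀ r ∈ R, ExtendScalars.map (ε.restrictScalars F) (LieHom.id : L →ₗ⁅F⁆ L) r = 0)
    (hR : ∀ r ∈ R, ∀ j, (D j).baseChangeCoeff L r = ⁅(1 : B) ⊗ₜ[F] b j, r⁆ ∨
      (D j).baseChangeCoeff L r = 0) :
    ∃ (A : Type) (_ : CommRing A) (_ : Algebra K A) (_ : Algebra F A) (_ : IsScalarTower F K A)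
      (f : B →ₐ[K] A) (ε' : A →ₐ[K] K) (D' : Fin n → Derivation F A A),
      Module.Finite K A ∧ Function.Surjective f ∧ (∀ u, ε' (f u) = ε u) ∧
      (∀ u, ε' u ≠ 0 → IsUnit u) ∧ (∀ i u, D' i (f u) = f (D i u)) ∧
      ∀ r ∈ R, ExtendScalars.map (f.restrictScalars F) (LieHom.id : L →ₗ⁅F⁆ L) r = 0 := by
  have hp : p ≠ 0 := (Fact.out : p.Prime).ne_zero
  let J : Ideal B := Ideal.span (Set.range (fun u ↦ u ^ p - algebraMap K B (ε u) ^ p) ∪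
    {c | ∃ r ∈ R, ∃ k, (b.baseChange B).repr r k = c})
  have hJpow : ∀ u, u ^ p - algebraMap K B (ε u) ^ p ∈ J := fun u ↦
    Ideal.subset_span (Or.inl ⟨u, rfl⟩)
  have hJR : ∀ r ∈ R, ∀ k, (b.baseChange B).repr r k ∈ J := fun r hr k ↦
    Ideal.subset_span (Or.inr ⟨r, hr, k, rfl⟩)
  have hJε : ∀ u ∈ J, ε u = 0 := by
    have : J ≤ RingHom.ker ε := by
      refine Ideal.span_le.mpr ?_
      rintro _ (⟨u, rfl⟩ | ⟨r, hr, k, rfl⟩)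
      · simp [RingHom.mem_ker]
      · change (ε.restrictScalars F) _ = 0
        rw [← repr_map_baseChange, hε r hr]
        simp
    exact fun u hu ↦ this hu
  have hJD : ∀ i, ∀ u ∈ J, D i u ∈ J := by
    intro i u hu
    induction hu using Submodule.span_induction with
    | mem u hu =>
      rcases hu with ⟨u, rfl⟩ | ⟨r, hr, k, rfl⟩
      · simp only [map_sub, Derivation.apply_pow_char_eq_zero, sub_zero, zero_mem]
      · rw [← repr_baseChangeCoeff]
        rcases hR r hr i with h | h
        · rw [h, repr_lie_one_tmul]
          refine Ideal.sum_mem _ fun m _ ↦ ?_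
          rw [← algebraMap_smul B, smul_eq_mul]
          exact J.mul_mem_left _ (hJR r hr m)
        · rw [h]
          simp
    | zero => simp
    | add u v _ _ hu hv => rw [map_add]; exact J.add_mem hu hv
    | smul a u hu' hu =>
      rw [smul_eq_mul, Derivation.leibniz]
      exact J.add_mem (J.mul_mem_left _ hu) (J.mul_mem_right _ hu')
  have hsurj : Function.Surjective (Ideal.Quotient.mkₐ K J) := Ideal.Quotient.mkₐ_surjective K J
  have hpow : ∀ u, Ideal.Quotient.mkₐ K J u ^ p = algebraMap K (B ⧸ J) (ε u ^ p) := by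
    intro u
    have := Ideal.Quotient.eq.mpr (hJpow u)
    rw [map_pow]
    exact this
  have hsurjF : Function.Surjective (Ideal.Quotient.mkₐ F J) := Ideal.Quotient.mkₐ_surjective F J
  refine ⟨B ⧸ J, inferInstance, inferInstance, inferInstance, inferInstance,
    Ideal.Quotient.mkₐ K J, Ideal.Quotient.liftₐ J ε hJε,
    fun i ↦ Derivation.liftOfSurjective hsurjF (d := D i) fun u hu ↦ ?_,
    ?_, hsurj, fun u ↦ rfl, ?_, fun i u ↦ ?_, fun r hr ↦ ?_⟩
  · exact Ideal.Quotient.eq_zero_iff_mem.mpr (hJD i u (Ideal.Quotient.eq_zero_iff_mem.mp hu))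
  · have : Algebra.FiniteType K (B ⧸ J) := Algebra.FiniteType.of_surjective _ hsurj
    have : Algebra.IsIntegral K (B ⧸ J) := ⟨fun u ↦ by
      obtain ⟨u, rfl⟩ := hsurj u
      refine IsIntegral.of_pow (Nat.pos_of_ne_zero hp) ?_
      rw [hpow]
      exact isIntegral_algebraMap⟩
    exact Algebra.IsIntegral.finite
  · intro u hu
    obtain ⟨u, rfl⟩ := hsurj u
    rw [← isUnit_pow_iff hp, hpow]
    exact (IsUnit.mk0 _ (pow_ne_zero p hu)).map (algebraMap K (B ⧸ J))
  · exact Derivation.liftOfSurjective_apply hsurjF _ u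
  · refine (b.baseChange (B ⧸ J)).repr.injective (Finsupp.ext fun k ↦ ?_)
    rw [repr_map_baseChange, map_zero]
    exact Ideal.Quotient.eq_zero_iff_mem.mpr (hJR r hr k)

end FrobeniusQuotient

section Model

open TensorProduct LieAlgebra MvPolynomial

variable {F L K : Type} [Field F] [LieRing L] [LieAlgebra F L] [Field K] [Algebra F K] {n p : ℕ}

/-- The derivation of the polynomial ring in the entries of `n` generic matrices and one further
variable `E` given by `G i ↦ ad (b i) * G i`, `G j ↦ 0` for `j ≠ i`, and `E ↦ χ (b i) * E`. -/
noncomputable def genericDerivation (b : Module.Basis (Fin n) F L) (χ : L →ₗ[F] K) (i : Fin n) :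
    Derivation K (MvPolynomial (Option (Fin n × Fin n × Fin n)) K)
      (MvPolynomial (Option (Fin n × Fin n × Fin n)) K) :=
  mkDerivation K fun s ↦ s.elim (χ (b i) • X none) fun t ↦
    if i = t.1 then ∑ m, b.repr ⁅b i, b m⁆ t.2.1 • X (some (t.1, m, t.2.2)) else 0

theorem genericDerivation_none (b : Module.Basis (Fin n) F L) (χ : L →ₗ[F] K) (i : Fin n) :
    genericDerivation b χ i (X none) = χ (b i) • X none := by
  rw [genericDerivation, mkDerivation_X]
  rfl

theorem genericDerivation_some_self (b : Module.Basis (Fin n) F L) (χ : L →ₗ[F] K)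
    (i k l : Fin n) : genericDerivation b χ i (X (some (i, k, l))) =
      ∑ m, b.repr ⁅b i, b m⁆ k • X (some (i, m, l)) := by
  rw [genericDerivation, mkDerivation_X]
  exact if_pos rfl

theorem genericDerivation_some_of_ne (b : Module.Basis (Fin n) F L) (χ : L →ₗ[F] K)
    {i j : Fin n} (h : i ≠ j) (k l : Fin n) :
    genericDerivation b χ i (X (some (j, k, l))) = 0 := by
  rw [genericDerivation, mkDerivation_X]
  exact if_neg h

theorem genericDerivation_comm (b : Module.Basis (Fin n) F L) (χ : L →ₗ[F] K) (i j : Fin n)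
    (u : MvPolynomial (Option (Fin n × Fin n × Fin n)) K) :
    genericDerivation b χ i (genericDerivation b χ j u) =
      genericDerivation b χ j (genericDerivation b χ i u) := by
  obtain rfl | hij := eq_or_ne i j
  · rfl
  have hF : ∀ (i : Fin n) (t : F) u,
      genericDerivation b χ i (t • u) = t • genericDerivation b χ i u := fun i t u ↦ by
    rw [← algebraMap_smul K t u, Derivation.map_smul, algebraMap_smul]
  have h : ⁅genericDerivation b χ i, genericDerivation b χ j⁆ = 0 := by
    refine derivation_ext ?_
    rintro (_ | ⟨m, k, l⟩)
    · rw [Derivation.commutator_apply, genericDerivation_none, genericDerivation_none,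
        Derivation.map_smul, Derivation.map_smul, genericDerivation_none,
        genericDerivation_none, smul_smul, smul_smul, mul_comm, sub_self]
      rfl
    · rw [Derivation.commutator_apply]
      have h0 : ∀ i j : Fin n, i ≠ j → genericDerivation b χ i
          (genericDerivation b χ j (X (some (m, k, l)))) = 0 := by
        intro i j hij
        obtain rfl | hjm := eq_or_ne j m
        · rw [genericDerivation_some_self, map_sum]
          refine Finset.sum_eq_zero fun r _ ↦ ?_
          rw [hF, genericDerivation_some_of_ne b χ hij, smul_zero]
        · rw [genericDerivation_some_of_ne b χ hjm, map_zero]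
      rw [h0 i j hij, h0 j i hij.symm, sub_self]
      rfl
  have := congrArg (fun D ↦ D u) h
  rw [Derivation.commutator_apply] at this
  exact sub_eq_zero.mp this

/-- A finite-dimensional commutative `K`-algebra on which `L` acts by `K`-linear derivations in
such a way that the part of the basis `b` that spans an abelian ideal acts on a suitable unit
`E` through an arbitrary linear form `χ`. -/
theorem exists_derivation_action [Fact p.Prime] [CharP F p] (b : Module.Basis (Fin n) F L)
    (S : LieIdeal F L) (hS : ∀ x ∈ S, ∀ y ∈ S, ⁅x, y⁆ = (0 : L)) (k : ℕ)
    (hb : ∀ i : Fin n, i < k → b i ∈ S) (χ : L →ₗ[F] K) :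
    ∃ (A : Type) (_ : CommRing A) (_ : Algebra K A) (_ : Algebra F A) (_ : IsScalarTower F K A)
      (ρ : L →ₗ⁅F⁆ Derivation F A A) (E : A), Module.Finite K A ∧ Nontrivial A ∧ IsUnit E ∧
      (∀ x c, ρ x (algebraMap K A c) = 0) ∧
      ∀ i : Fin n, i < k → ρ (b i) E = -(χ (b i) • E) := by
  let B := MvPolynomial (Option (Fin n × Fin n × Fin n)) K
  let D : Fin n → Derivation F B B := fun i ↦ (genericDerivation b χ i).restrictScalars F
  let g : Fin n → Fin n → Fin n → B := fun i k l ↦ X (some (i, k, l))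
  let ε : B →ₐ[K] K := aeval fun s ↦ s.elim 1 fun t ↦ if t.2.1 = t.2.2 then 1 else 0
  have hεg : ∀ i k l, ε (g i k l) = if k = l then 1 else 0 := fun i k l ↦
    aeval_X _ _
  have hg : ∀ i k l, D i (g i k l) = ∑ m, b.repr ⁅b i, b m⁆ k • g i m l :=
    genericDerivation_some_self b χ
  have hg0 : ∀ i j, i ≠ j → ∀ k l, D i (g j k l) = 0 := fun i j ↦
    genericDerivation_some_of_ne b χ
  have hGself : ∀ i x, (D i).baseChangeCoeff L (matrixBaseChange b (g i) (1 ⊗ₜ x)) =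
      ⁅(1 : B) ⊗ₜ[F] b i, matrixBaseChange b (g i) (1 ⊗ₜ x)⁆ := fun i x ↦ by
    rw [baseChangeCoeff_matrixBaseChange_of_apply_eq_ad b (b i) _ _ (hg i)]
    simp
  have hGne : ∀ i j, j ≠ i → ∀ x,
      (D j).baseChangeCoeff L (matrixBaseChange b (g i) (1 ⊗ₜ x)) = 0 := fun i j hij x ↦ by
    rw [baseChangeCoeff_matrixBaseChange_of_apply_eq_zero b _ _ (hg0 j i hij)]
    simp
  have hεG : ∀ i v, ExtendScalars.map (ε.restrictScalars F) (LieHom.id : L →ₗ⁅F⁆ L)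
      (matrixBaseChange b (g i) v) =
        ExtendScalars.map (ε.restrictScalars F) (LieHom.id : L →ₗ⁅F⁆ L) v := fun i v ↦ by
    rw [map_matrixBaseChange]
    simp only [AlgHom.restrictScalars_apply, hεg]
    rw [matrixBaseChange_one]
  let R : Set (B ⊗[F] L) := {r |
    ExtendScalars.map (ε.restrictScalars F) (LieHom.id : L →ₗ⁅F⁆ L) r = 0 ∧
    ∀ j, (D j).baseChangeCoeff L r = ⁅(1 : B) ⊗ₜ[F] b j, r⁆ ∨ (D j).baseChangeCoeff L r = 0}
  have hRlie : ∀ i x y, matrixBaseChange b (g i) (1 ⊗ₜ ⁅x, y⁆) -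
      ⁅matrixBaseChange b (g i) (1 ⊗ₜ x), matrixBaseChange b (g i) (1 ⊗ₜ y)⁆ ∈ R := by
    intro i x y
    refine ⟨?_, fun j ↦ ?_⟩
    · rw [map_sub, LieHom.map_lie, hεG, hεG, hεG, ← LieHom.map_lie,
        ExtendScalars.bracket_tmul, one_mul, sub_self]
    · rw [map_sub, Derivation.baseChangeCoeff_lie]
      obtain rfl | hij := eq_or_ne j i
      · left
        rw [hGself, hGself, hGself]
        refine Eq.trans ?_ (lie_sub ((1 : B) ⊗ₜ[F] b j) _ _).symm
        rw [leibniz_lie ((1 : B) ⊗ₜ[F] b j)]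
      · right
        rw [hGne i j hij, hGne i j hij, hGne i j hij, zero_lie, lie_zero, add_zero, sub_zero]
  have hRS : ∀ i : Fin n, i < k → ∀ s ∈ S,
      matrixBaseChange b (g i) (1 ⊗ₜ s) - 1 ⊗ₜ s ∈ R := by
    intro i hi s hs
    refine ⟨?_, fun j ↦ ?_⟩
    · rw [map_sub, hεG, sub_self]
    · rw [map_sub, Derivation.baseChangeCoeff_tmul, Derivation.map_one_eq_zero,
        TensorProduct.zero_tmul, sub_zero]
      obtain rfl | hij := eq_or_ne j i
      · left
        rw [hGself]
        refine Eq.trans ?_ (lie_sub ((1 : B) ⊗ₜ[F] b j) _ _).symm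
        rw [ExtendScalars.bracket_tmul F B L L 1 1 (b j) s, hS _ (hb j hi) _ hs,
          TensorProduct.tmul_zero, sub_zero]
      · exact .inr (hGne i j hij s)
  obtain ⟨A, _, _, _, _, f, ε', D', hfin, hf, hε', hunit, hD', hfR⟩ :=
    exists_finite_quotient (p := p) b D ε R (fun r hr ↦ hr.1) (fun r hr ↦ hr.2)
  have hfG : ∀ i x, ExtendScalars.map (f.restrictScalars F) (LieHom.id : L →ₗ⁅F⁆ L)
      (matrixBaseChange b (g i) (1 ⊗ₜ x)) =
        matrixBaseChange b (fun k l ↦ f (g i k l)) (1 ⊗ₜ x) := fun i x ↦ by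
    rw [map_matrixBaseChange]
    congr 1
    exact congrArg (· ⊗ₜ[F] x) (map_one f)
  have hlie : ∀ i v w, matrixBaseChange b (fun k l ↦ f (g i k l)) ⁅v, w⁆ =
      ⁅matrixBaseChange b (fun k l ↦ f (g i k l)) v,
        matrixBaseChange b (fun k l ↦ f (g i k l)) w⁆ := by
    intro i v w
    have h1 : ∀ (a : A) (x : L), a ⊗ₜ[F] x = a • (1 : A) ⊗ₜ[F] x := fun a x ↦ by
      rw [TensorProduct.smul_tmul', smul_eq_mul, mul_one]
    induction v with
    | zero => simp
    | tmul c x =>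
      induction w with
      | zero => simp
      | tmul d y =>
        have := hfR _ (hRlie i x y)
        rw [map_sub, LieHom.map_lie, hfG, hfG, hfG, sub_eq_zero] at this
        rw [ExtendScalars.bracket_tmul, h1 c x, h1 d y, h1 (c * d), map_smul, map_smul, map_smul,
          this, smul_lie, lie_smul, smul_smul]
      | add v w hv hw => simp only [lie_add, map_add, hv, hw]
    | add v w hv hw => simp only [add_lie, map_add, hv, hw]
  obtain ⟨ρ, hρK, hρb⟩ := exists_lieHom_derivation b D'
    (fun i j a ↦ by
      obtain ⟨u, rfl⟩ := hf a
      simp only [hD']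
      exact congrArg f (genericDerivation_comm b χ i j u))
    (fun i k l ↦ f (g i k l))
    (fun i k l ↦ by
      rw [hD', hg, map_sum]
      exact Finset.sum_congr rfl fun m _ ↦ map_smul (f.restrictScalars F) _ _)
    (fun i j hij k l ↦ by rw [hD', hg0 i j hij, map_zero])
    hlie (ε'.restrictScalars F)
    (fun i k l ↦ by rw [AlgHom.restrictScalars_apply, hε', hεg])
    hunit
  refine ⟨A, inferInstance, inferInstance, inferInstance, inferInstance, ρ, f (X none), hfin,
    ε'.toRingHom.domain_nontrivial, hunit _ ?_, fun x c ↦ hρK _ (fun i ↦ ?_) x, fun i hi ↦ ?_⟩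
  · rw [hε']
    exact (aeval_X _ _).trans_ne one_ne_zero
  · rw [← f.commutes, hD']
    change f (genericDerivation b χ i (algebraMap K B c)) = 0
    rw [Derivation.map_algebraMap, map_zero]
  · rw [hρb i, hD']
    · change -f (genericDerivation b χ i (X none)) = _
      rw [genericDerivation_none, map_smul]
    · intro j hj
      have := hfR _ (hRS j (lt_trans hj hi) (b i) (hb i hi))
      rw [map_sub, hfG, sub_eq_zero] at this
      rw [this]
      exact congrArg (· ⊗ₜ[F] b i) (map_one f)

end Model

section Irreducible

open LieModule

theorem LieSubmodule.isIrreducible_of_isAtom {F L V : Type*} [CommRing F] [LieRing L]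
    [AddCommGroup V] [Module F V] [LieRingModule L V] {W : LieSubmodule F L V} (hW : IsAtom W) :
    LieModule.IsIrreducible F L W := by
  have : Nontrivial W := (LieSubmodule.nontrivial_iff_ne_bot F L V).mpr hW.1
  refine LieModule.IsIrreducible.mk fun N hN ↦ ?_
  have hle : N.map W.incl ≤ W := by
    rintro _ ⟨w, -, rfl⟩
    exact w.2
  rcases hW.le_iff.mp hle with h | h
  · refine (hN ?_).elim
    rw [LieSubmodule.eq_bot_iff]
    intro w hw
    have : (w : V) ∈ N.map W.incl := ⟨w, hw, rfl⟩
    rw [h, LieSubmodule.mem_bot] at this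
    exact Subtype.ext this
  · rw [eq_top_iff]
    rintro w -
    have : (w : V) ∈ N.map W.incl := h.ge w.2
    obtain ⟨w', hw', h'⟩ := this
    exact Subtype.ext h' ▸ hw'

variable {F L V : Type*} [Field F] [LieRing L] [LieAlgebra F L] [AddCommGroup V] [Module F V]
  [LieRingModule L V] [LieModule F L V]

theorem pow_succ_mul_of_commute_sub {R : Type*} [Ring R] {x y z : R} (hz : x * y = y * x + z)
    (hxz : Commute x z) (m : ℕ) :
    x ^ (m + 1) * y = y * x ^ (m + 1) + (m + 1) • (z * x ^ m) := by
  induction m with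
  | zero => simp [hz]
  | succ m ih =>
    have h1 : x * (y * x ^ (m + 1)) = y * x ^ (m + 2) + z * x ^ (m + 1) := by
      rw [← mul_assoc, hz, add_mul, mul_assoc, ← pow_succ']
    have h2 : x * (z * x ^ m) = z * x ^ (m + 1) := by
      rw [← mul_assoc, hxz.eq, mul_assoc, ← pow_succ']
    rw [pow_succ' x (m + 1), mul_assoc, ih, mul_add, mul_smul_comm, h1, h2, ← pow_succ',
      succ_nsmul' _ (m + 1), add_assoc]

/-- The `p`-th powers of the elements of an abelian ideal act centrally in characteristic `p`. -/
theorem commute_toEnd_pow_char {p : ℕ} [Fact p.Prime] [CharP F p] {S : LieIdeal F L}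
    (hS : ∀ x ∈ S, ∀ y ∈ S, ⁅x, y⁆ = (0 : L)) {s : L} (hs : s ∈ S) (a : L) :
    Commute (toEnd F L V s ^ p) (toEnd F L V a) := by
  obtain ⟨m, hm⟩ := Nat.exists_eq_succ_of_ne_zero (Fact.out : p.Prime).ne_zero
  have hz : toEnd F L V s * toEnd F L V a = toEnd F L V a * toEnd F L V s +
      toEnd F L V ⁅s, a⁆ := by
    ext v
    simp only [LinearMap.add_apply, Module.End.mul_apply, toEnd_apply_apply]
    rw [leibniz_lie, add_comm]
  have hsz : Commute (toEnd F L V s) (toEnd F L V ⁅s, a⁆) := by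
    ext v
    simp only [Module.End.mul_apply, toEnd_apply_apply]
    rw [leibniz_lie, hS s hs _ (lie_mem_left F L S s a hs), zero_lie, zero_add]
  have := pow_succ_mul_of_commute_sub hz hsz m
  rw [← Nat.succ_eq_add_one, ← hm, ← Nat.cast_smul_eq_nsmul F, CharP.cast_eq_zero, zero_smul,
    add_zero] at this
  exact this

variable {K : Type*} [Field K] [Module K V]

/-- If the abelian ideal `S` acts on some nonzero vector through a function that vanishes only at
zero, then there is an irreducible submodule on which each nonzero element of `S` acts
non-trivially. -/
theorem exists_isIrreducible_lieSubmodule {p : ℕ} [Fact p.Prime] [CharP F p]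
    [FiniteDimensional F V] [SMulCommClass F K V]
    (hK : ∀ (x : L) (c : K) (v : V), ⁅x, c • v⁆ = c • ⁅x, v⁆)
    {S : LieIdeal F L} (hS : ∀ x ∈ S, ∀ y ∈ S, ⁅x, y⁆ = (0 : L))
    {χ : L → K} (hχ : ∀ s ∈ S, s ≠ 0 → χ s ≠ 0) {v : V} (hv0 : v ≠ 0)
    (hv : ∀ s ∈ S, ⁅s, v⁆ = χ s • v) :
    ∃ W : LieSubmodule F L V, LieModule.IsIrreducible F L W ∧
      ∀ s ∈ S, s ≠ 0 → ∃ w ∈ W, ⁅s, w⁆ ≠ 0 := by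
  have hp : p ≠ 0 := (Fact.out : p.Prime).ne_zero
  let Y : LieSubmodule F L V :=
    { carrier := {u | ∀ s ∈ S, (toEnd F L V s ^ p) u = χ s ^ p • u}
      add_mem' := fun {u v} hu hv s hs ↦ by rw [map_add, hu s hs, hv s hs, smul_add]
      zero_mem' := fun s _ ↦ by simp
      smul_mem' := fun c u hu s hs ↦ by rw [map_smul, hu s hs, smul_comm]
      lie_mem := fun {x u} hu s hs ↦ by
        have h := LinearMap.congr_fun (commute_toEnd_pow_char (V := V) hS hs x).eq u
        rw [Module.End.mul_apply, Module.End.mul_apply, hu s hs] at h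
        exact h.trans (hK x _ u) }
  have hpow : ∀ s ∈ S, ∀ m : ℕ, (toEnd F L V s ^ m) v = χ s ^ m • v := by
    intro s hs m
    induction m with
    | zero => simp
    | succ m ih =>
      rw [pow_succ', Module.End.mul_apply, ih, toEnd_apply_apply, hK, hv s hs, smul_smul, pow_succ]
  have hY : Y ≠ ⊥ := by
    intro h
    have : v ∈ Y := fun s hs ↦ hpow s hs p
    rw [h, LieSubmodule.mem_bot] at this
    exact hv0 this
  obtain h | ⟨W, hW, hWY⟩ := IsAtomic.eq_bot_or_exists_atom_le Y
  · exact (hY h).elim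
  refine ⟨W, LieSubmodule.isIrreducible_of_isAtom hW, fun s hs hs0 ↦ ?_⟩
  by_contra! h
  refine hW.1 ((LieSubmodule.eq_bot_iff W).mpr fun w hw ↦ ?_)
  have h1 : (toEnd F L V s ^ p) w = χ s ^ p • w := hWY hw s hs
  obtain ⟨m, rfl⟩ := Nat.exists_eq_succ_of_ne_zero hp
  rw [pow_succ, Module.End.mul_apply, toEnd_apply_apply, h w hw, map_zero] at h1
  exact (smul_eq_zero.mp h1.symm).resolve_left (pow_ne_zero _ (hχ s hs hs0))

end Irreducible

section AbelianSocle

variable {F L : Type*} [Field F] [LieRing L] [LieAlgebra F L]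

theorem lie_eq_zero_of_mem_sSup_abelian_atoms {x y : L}
    (hx : x ∈ sSup {A : LieIdeal F L | IsAtom A ∧ ∀ a ∈ A, ∀ b ∈ A, ⁅a, b⁆ = (0 : L)})
    (hy : y ∈ sSup {A : LieIdeal F L | IsAtom A ∧ ∀ a ∈ A, ∀ b ∈ A, ⁅a, b⁆ = (0 : L)}) :
    ⁅x, y⁆ = 0 := by
  have key : ∀ z : L, (∀ A : LieIdeal F L, IsAtom A → (∀ a ∈ A, ∀ b ∈ A, ⁅a, b⁆ = (0 : L)) →
      ∀ a ∈ A, ⁅z, a⁆ = 0) →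
      ∀ y ∈ sSup {A : LieIdeal F L | IsAtom A ∧ ∀ a ∈ A, ∀ b ∈ A, ⁅a, b⁆ = (0 : L)},
        ⁅z, y⁆ = 0 := by
    intro z hz y hy
    rw [← LieSubmodule.mem_toSubmodule, LieSubmodule.sSup_toSubmodule] at hy
    have : sSup {((s : LieIdeal F L) : Submodule F L) | s ∈ {A : LieIdeal F L | IsAtom A ∧
        ∀ a ∈ A, ∀ b ∈ A, ⁅a, b⁆ = (0 : L)}} ≤ LinearMap.ker (LieAlgebra.ad F L z) := by
      refine sSup_le ?_
      rintro _ ⟨A, ⟨hA, hA'⟩, rfl⟩ a ha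
      exact hz A hA hA' a ha
    exact this hy
  refine key x (fun A hA hA' a ha ↦ ?_) y hy
  rw [← lie_skew, neg_eq_zero]
  refine key a (fun B hB hB' b hb ↦ ?_) x hx
  obtain rfl | hAB := eq_or_ne A B
  · exact hA' a ha b hb
  · have : ⁅a, b⁆ ∈ A ⊓ B := ⟨lie_mem_left F L A a b ha, lie_mem_right F L B a b hb⟩
    rwa [(hA.disjoint_of_ne hB hAB).eq_bot, LieSubmodule.mem_bot] at this

end AbelianSocle

theorem Submodule.exists_basis_fin {F V : Type*} [Field F] [AddCommGroup V] [Module F V]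
    [FiniteDimensional F V] (S : Submodule F V) :
    ∃ (n k : ℕ) (b : Module.Basis (Fin n) F V), (∀ i : Fin n, i < k → b i ∈ S) ∧
      S ≤ Submodule.span F (b '' {i | (i : ℕ) < k}) := by
  obtain ⟨T, hT⟩ := S.exists_isCompl
  let b := (((Module.finBasis F S).prod (Module.finBasis F T)).map
    (Submodule.prodEquivOfIsCompl S T hT)).reindex finSumFinEquiv
  have hb : ∀ i, b (Fin.castAdd _ i) = Module.finBasis F S i := fun i ↦ by simp [b]
  refine ⟨_, Module.finrank F S, b, fun i hi ↦ ?_, fun s hs ↦ ?_⟩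
  · obtain ⟨j, rfl⟩ : ∃ j, i = Fin.castAdd _ j := ⟨⟨i, hi⟩, rfl⟩
    rw [hb]
    exact Subtype.mem _
  · have h := congrArg S.subtype ((Module.finBasis F S).sum_repr ⟨s, hs⟩)
    rw [map_sum] at h
    rw [← show _ = s from h]
    refine Submodule.sum_mem _ fun i _ ↦ ?_
    rw [map_smul, Submodule.subtype_apply, ← hb]
    exact Submodule.smul_mem _ _ (Submodule.subset_span ⟨_, by simp, rfl⟩)

/-- Let `L` be a finite-dimensional restricted Lie algebra over a field
`F` of characteristic `p > 0` that is not algebraically closed, whose `p`-operation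
vanishes on the abelian socle (the sum of all abelian minimal ideals).  Then there is a
finite-dimensional irreducible `L`-module `V₀` on which every abelian minimal ideal of
`L` acts non-trivially. -/
theorem exists_irreducible_module_nontrivial_on_abelian_minimal_ideals
    {F L : Type} [Field F] [LieRing L] [LieAlgebra F L] {p : ℕ}
    [Fact p.Prime] [CharP F p] [FiniteDimensional F L]
    (hF : ¬ IsAlgClosed F)
    (P : POperation F L p)
    (hsoc : ∀ x ∈ sSup {A : LieIdeal F L |
        IsAtom A ∧ ∀ a ∈ A, ∀ b ∈ A, ⁅a, b⁆ = (0 : L)}, P.pOp x = 0) :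
    Nonempty (IrredModAbelianFaithful F L) := by
  set S := sSup {A : LieIdeal F L | IsAtom A ∧ ∀ a ∈ A, ∀ b ∈ A, ⁅a, b⁆ = (0 : L)}
  have hS : ∀ x ∈ S, ∀ y ∈ S, ⁅x, y⁆ = (0 : L) := fun x hx y hy ↦
    lie_eq_zero_of_mem_sSup_abelian_atoms hx hy
  obtain ⟨K, _, _, _, hK⟩ := exists_finiteDimensional_le_finrank hF p (Module.finrank F S)
  obtain ⟨χ₀, hχ₀⟩ := (finrank_le_iff_exists_linearMap (R := F)).mp hK
  obtain ⟨χ, hχ⟩ := LinearMap.exists_extend (p := S.toSubmodule) χ₀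
  have hχS : ∀ s ∈ S, s ≠ 0 → χ s ≠ 0 := by
    intro s hs hs0 h
    have h1 : χ₀ ⟨s, hs⟩ = χ s := (LinearMap.congr_fun hχ ⟨s, hs⟩).symm
    rw [h] at h1
    exact hs0 (congrArg Subtype.val (hχ₀ (h1.trans (map_zero χ₀).symm)))
  obtain ⟨n, k, b, hbS, hSb⟩ := S.toSubmodule.exists_basis_fin
  obtain ⟨A, _, _, _, _, ρ, E, _, _, hE, hρK, hρE⟩ :=
    exists_derivation_action (p := p) b S hS k hbS χ
  have : FiniteDimensional F A := Module.Finite.trans K A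
  let _ : LieRingModule L A :=
    { bracket := fun x a ↦ ρ x a
      add_lie := fun x y a ↦ by rw [map_add, Derivation.add_apply]
      lie_add := fun x a c ↦ map_add (ρ x) a c
      leibniz_lie := fun x y a ↦ by
        rw [LieHom.map_lie, Derivation.commutator_apply, sub_add_cancel] }
  have hbracket : ∀ (x : L) (a : A), ⁅x, a⁆ = ρ x a := fun _ _ ↦ rfl
  let _ : LieModule F L A :=
    { smul_lie := fun t x a ↦ by
        rw [hbracket, hbracket, map_smul, Derivation.smul_apply]
      lie_smul := fun t x a ↦ (ρ x).map_smul t a }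
  have hSE : ∀ s ∈ S, ⁅s, E⁆ = -χ s • E := by
    intro s hs
    rw [hbracket, neg_smul]
    have hs' := hSb hs
    clear hs
    induction hs' using Submodule.span_induction with
    | mem x hx =>
      obtain ⟨i, hi, rfl⟩ := hx
      exact hρE i hi
    | zero => simp
    | add x y _ _ hx hy => rw [map_add, map_add, Derivation.add_apply, hx, hy, add_smul, neg_add]
    | smul t x _ hx => rw [map_smul, map_smul, Derivation.smul_apply, hx, smul_neg, smul_assoc]
  obtain ⟨W, hW, hWS⟩ := exists_isIrreducible_lieSubmodule (F := F) (p := p)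
    (fun x (c : K) (a : A) ↦ by
      rw [hbracket, hbracket, Algebra.smul_def, Derivation.leibniz, hρK, smul_zero, add_zero,
        smul_eq_mul, ← Algebra.smul_def])
    hS (χ := fun s ↦ -χ s) (fun s hs hs0 ↦ neg_ne_zero.mpr (hχS s hs hs0)) hE.ne_zero hSE
  refine ⟨{ carrier := W, finDim := inferInstance, irred := hW, abelian_nontrivial := ?_ }⟩
  intro I hI hI' hIW
  obtain ⟨s, hs, hs0⟩ : ∃ s ∈ I, s ≠ 0 := by
    by_contra! h
    exact hI.1 ((LieSubmodule.eq_bot_iff I).mpr h)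
  obtain ⟨w, hw, hsw⟩ := hWS s ((le_sSup ⟨hI, hI'⟩ : I ≤ S) hs) hs0
  exact hsw (congrArg Subtype.val (hIW s hs ⟨w, hw⟩))
end
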